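/- For every λ ∈ 𝔫* and every integer e ≥ 0, the number of irreducible constituents of χ_λ of degree q^e equals the number of irreducible characters ψ of the algebra group S_λ/K_λ such that ψ(π(z)) = (|Gλ ∩ λG|/|Gλ|)·q^e·θ_λ(z) for all z ∈ L_λ. -/

import Mathlib

open scoped Classical BigOperators ComplexOrder

set_option linter.unusedSectionVars false
set_option linter.unusedVariables false

noncomputable section

namespace IterChar

/-! ### Generic notions for finite groups: inner product, induction, characters -/

/-- The standard inner product `⟨f,h⟩_G = |G|⁻¹ ∑_{x ∈ G} f x * conj (h x)`. -/
def innerG (G : Type) [Group G] (f h : G → ℂ) : ℂ :=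
  (Nat.card G : ℂ)⁻¹ * ∑ᶠ x : G, f x * (starRingEnd ℂ) (h x)

/-- Induction of a function from a subgroup, via the Frobenius formula. -/
def indFun {G : Type} [Group G] (H : Subgroup G) (ψ : ↥H → ℂ) : G → ℂ :=
  fun g => (Nat.card ↥H : ℂ)⁻¹ *
    ∑ᶠ x : G, if h : x * g * x⁻¹ ∈ H then ψ ⟨x * g * x⁻¹, h⟩ else 0

/-- A function `G → ℂ` is a character if it is the trace character of some
finite-dimensional complex representation. -/
def IsCharacter (G : Type) [Group G] (f : G → ℂ) : Prop :=
  ∃ V : FDRep ℂ G, f = FDRep.character V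

/-- The set of irreducible characters of `G`: characters of norm one. -/
def Irr (G : Type) [Group G] : Set (G → ℂ) :=
  {f | IsCharacter G f ∧ innerG G f f = 1}

/-- The set of irreducible constituents of `χ`: irreducible characters with
`⟨χ, ψ⟩_G > 0` (using the complex partial order). -/
def IrrConstituents (G : Type) [Group G] (χ : G → ℂ) : Set (G → ℂ) :=
  {f | f ∈ Irr G ∧ 0 < innerG G χ f}

/-! ### Algebra groups -/

variable {F : Type} [Field F] [Fintype F] {R : Type} [Ring R] [Algebra F R] [Fintype R]

/-- `J` is a nilpotent (non-unital) subalgebra: all products of some fixed length vanish. -/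
def IsNil (J : NonUnitalSubalgebra F R) : Prop :=
  ∃ N : ℕ, ∀ l : List R, (∀ x ∈ l, x ∈ J) → l.length = N → l.prod = 0

/-- The algebra group `G = 1 + J` of a (nilpotent) subalgebra `J ⊆ R`, realized as the
subgroup of units `u` of `R` with `u - 1 ∈ J` (and `u⁻¹ - 1 ∈ J`, which is automatic
when `J` is nilpotent). -/
def algGroup (F : Type) [Field F] [Fintype F] (R : Type) [Ring R] [Algebra F R] [Fintype R]
    (J : NonUnitalSubalgebra F R) : Subgroup Rˣ where
  carrier := {u : Rˣ | ((u : R) - 1 ∈ J) ∧ (((u⁻¹ : Rˣ) : R) - 1 ∈ J)}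
  one_mem' := by
    constructor <;> · simp only [Units.val_one, inv_one, sub_self]; exact J.zero_mem
  mul_mem' := by
    rintro u v ⟨hu1, hu2⟩ ⟨hv1, hv2⟩
    constructor
    · have h : ((u * v : Rˣ) : R) - 1 =
          ((u : R) - 1) * ((v : R) - 1) + ((u : R) - 1) + ((v : R) - 1) := by
        push_cast; noncomm_ring
      rw [h]
      exact add_mem (add_mem (mul_mem hu1 hv1) hu1) hv1
    · have h : (((u * v)⁻¹ : Rˣ) : R) - 1 =
          (((v⁻¹ : Rˣ) : R) - 1) * (((u⁻¹ : Rˣ) : R) - 1) +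
            (((v⁻¹ : Rˣ) : R) - 1) + (((u⁻¹ : Rˣ) : R) - 1) := by
        rw [mul_inv_rev]; push_cast; noncomm_ring
      rw [h]
      exact add_mem (add_mem (mul_mem hv2 hu2) hv2) hu2
  inv_mem' := by
    rintro u ⟨h1, h2⟩
    exact ⟨h2, by simpa using h1⟩

theorem mem_algGroup {J : NonUnitalSubalgebra F R} {u : Rˣ} :
    u ∈ algGroup F R J ↔ ((u : R) - 1 ∈ J) ∧ (((u⁻¹ : Rˣ) : R) - 1 ∈ J) :=
  Iff.rfl

/-- The element `X ∈ J` such that `g = 1 + X`. -/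
def gElt {J : NonUnitalSubalgebra F R} (g : ↥(algGroup F R J)) : ↥J :=
  ⟨((g : Rˣ) : R) - 1, g.2.1⟩

/-- The function `θ_λ(1+X) = θ(λ(X))` on the algebra group `1 + J`. -/
def thetaFn (θ : AddChar F ℂ) (J : NonUnitalSubalgebra F R) (lam : ↥J →ₗ[F] F) :
    ↥(algGroup F R J) → ℂ :=
  fun g => θ (lam (gElt g))

/-- Left multiplication by the group element `g` as a linear endomorphism of `J`. -/
def lmulMap {J : NonUnitalSubalgebra F R} (g : ↥(algGroup F R J)) : ↥J →ₗ[F] ↥J where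
  toFun X := ⟨((g : Rˣ) : R) * (X : R), by
    have h : ((g : Rˣ) : R) * (X : R) = (((g : Rˣ) : R) - 1) * (X : R) + (X : R) := by
      noncomm_ring
    rw [h]; exact add_mem (mul_mem g.2.1 X.2) X.2⟩
  map_add' X Y := by ext; simp [mul_add]
  map_smul' c X := by ext; simp [mul_smul_comm]

/-- Right multiplication by the group element `g` as a linear endomorphism of `J`. -/
def rmulMap {J : NonUnitalSubalgebra F R} (g : ↥(algGroup F R J)) : ↥J →ₗ[F] ↥J where
  toFun X := ⟨(X : R) * ((g : Rˣ) : R), by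
    have h : (X : R) * ((g : Rˣ) : R) = (X : R) * (((g : Rˣ) : R) - 1) + (X : R) := by
      noncomm_ring
    rw [h]; exact add_mem (mul_mem X.2 g.2.1) X.2⟩
  map_add' X Y := by ext; simp [add_mul]
  map_smul' c X := by ext; simp [smul_mul_assoc]

/-- The left action of `G` on the dual space: `(gλ)(X) = λ(g⁻¹ X)`. -/
def leftAct {J : NonUnitalSubalgebra F R} (g : ↥(algGroup F R J)) (lam : ↥J →ₗ[F] F) :
    ↥J →ₗ[F] F :=
  lam.comp (lmulMap g⁻¹)

/-- The right action of `G` on the dual space: `(λg)(X) = λ(X g⁻¹)`. -/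
def rightAct {J : NonUnitalSubalgebra F R} (g : ↥(algGroup F R J)) (lam : ↥J →ₗ[F] F) :
    ↥J →ₗ[F] F :=
  lam.comp (rmulMap g⁻¹)

/-- The coadjoint action of `G` on the dual space: `λ^g(X) = λ(g X g⁻¹)`. -/
def coAct {J : NonUnitalSubalgebra F R} (g : ↥(algGroup F R J)) (lam : ↥J →ₗ[F] F) :
    ↥J →ₗ[F] F :=
  lam.comp ((lmulMap g).comp (rmulMap g⁻¹))

/-- The left orbit `Gλ`. -/
def leftOrbit (J : NonUnitalSubalgebra F R) (lam : ↥J →ₗ[F] F) : Set (↥J →ₗ[F] F) :=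
  Set.range fun g : ↥(algGroup F R J) => leftAct g lam

/-- The right orbit `λG`. -/
def rightOrbit (J : NonUnitalSubalgebra F R) (lam : ↥J →ₗ[F] F) : Set (↥J →ₗ[F] F) :=
  Set.range fun g : ↥(algGroup F R J) => rightAct g lam

/-- The two-sided orbit `GλG`. -/
def twoOrbit (J : NonUnitalSubalgebra F R) (lam : ↥J →ₗ[F] F) : Set (↥J →ₗ[F] F) :=
  {mu | ∃ g h : ↥(algGroup F R J), mu = leftAct g (rightAct h lam)}

/-- The coadjoint orbit `λ^G`. -/
def coOrbit (J : NonUnitalSubalgebra F R) (lam : ↥J →ₗ[F] F) : Set (↥J →ₗ[F] F) :=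
  Set.range fun g : ↥(algGroup F R J) => coAct g lam

/-- The right orbit of `λ` under a subgroup `H` of the algebra group. -/
def rightOrbitUnder (J : NonUnitalSubalgebra F R) (H : Subgroup ↥(algGroup F R J))
    (lam : ↥J →ₗ[F] F) : Set (↥J →ₗ[F] F) :=
  {mu | ∃ s ∈ H, mu = rightAct s lam}

/-- The Kirillov function `ψ_λ = |λ^G|^{-1/2} ∑_{μ ∈ λ^G} θ_μ`. -/
def kirillov (θ : AddChar F ℂ) (J : NonUnitalSubalgebra F R) (lam : ↥J →ₗ[F] F) :
    ↥(algGroup F R J) → ℂ :=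
  fun g => ((Real.sqrt (Nat.card ↥(coOrbit J lam)) : ℂ))⁻¹ *
    ∑ᶠ mu ∈ coOrbit J lam, thetaFn θ J mu g

/-- The supercharacter `χ_λ = (|Gλ|/|GλG|) ∑_{μ ∈ GλG} θ_μ`. -/
def superchar (θ : AddChar F ℂ) (J : NonUnitalSubalgebra F R) (lam : ↥J →ₗ[F] F) :
    ↥(algGroup F R J) → ℂ :=
  fun g => ((Nat.card ↥(leftOrbit J lam) : ℂ) / (Nat.card ↥(twoOrbit J lam) : ℂ)) *
    ∑ᶠ mu ∈ twoOrbit J lam, thetaFn θ J mu g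

/-! ### The subalgebras `𝔩_λ`, `𝔰_λ` and their iterates -/

/-- The extension of `λ : J → F` by zero to all of `R`. -/
def lamE (J : NonUnitalSubalgebra F R) (lam : ↥J →ₗ[F] F) (x : R) : F :=
  if h : x ∈ J then lam ⟨x, h⟩ else 0

theorem lamE_apply (J : NonUnitalSubalgebra F R) (lam : ↥J →ₗ[F] F) {x : R} (hx : x ∈ J) :
    lamE J lam x = lam ⟨x, hx⟩ := dif_pos hx

theorem lamE_zero (J : NonUnitalSubalgebra F R) (lam : ↥J →ₗ[F] F) : lamE J lam 0 = 0 := by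
  rw [lamE_apply J lam J.zero_mem]
  have h : (⟨(0 : R), J.zero_mem⟩ : ↥J) = 0 := Subtype.ext rfl
  rw [h, map_zero]

theorem lamE_add (J : NonUnitalSubalgebra F R) (lam : ↥J →ₗ[F] F) {x y : R}
    (hx : x ∈ J) (hy : y ∈ J) : lamE J lam (x + y) = lamE J lam x + lamE J lam y := by
  rw [lamE, lamE, lamE, dif_pos (add_mem hx hy), dif_pos hx, dif_pos hy]
  have h : (⟨x + y, add_mem hx hy⟩ : ↥J) = ⟨x, hx⟩ + ⟨y, hy⟩ := Subtype.ext rfl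
  rw [h, map_add]

theorem lamE_smul (J : NonUnitalSubalgebra F R) (lam : ↥J →ₗ[F] F) (c : F) {x : R}
    (hx : x ∈ J) : lamE J lam (c • x) = c * lamE J lam x := by
  rw [lamE, lamE, dif_pos (SMulMemClass.smul_mem c hx), dif_pos hx]
  have h : (⟨c • x, SMulMemClass.smul_mem c hx⟩ : ↥J) = c • ⟨x, hx⟩ := Subtype.ext rfl
  rw [h, map_smul]
  rfl

/-- The left kernel `𝔩` of the bilinear form `(X,Y) ↦ λ(XY)` restricted to `s × s`. -/
def lStep (J : NonUnitalSubalgebra F R) (lam : ↥J →ₗ[F] F)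
    (s : NonUnitalSubalgebra F R) (hs : s ≤ J) : NonUnitalSubalgebra F R where
  carrier := {x | x ∈ s ∧ ∀ y ∈ s, lamE J lam (x * y) = 0}
  zero_mem' := ⟨zero_mem s, fun y _ => by rw [zero_mul, lamE_zero]⟩
  add_mem' := by
    rintro a b ⟨ha1, ha2⟩ ⟨hb1, hb2⟩
    refine ⟨add_mem ha1 hb1, fun y hy => ?_⟩
    rw [add_mul, lamE_add J lam (J.mul_mem (hs ha1) (hs hy)) (J.mul_mem (hs hb1) (hs hy)),
      ha2 y hy, hb2 y hy, add_zero]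
  smul_mem' := by
    rintro c a ⟨ha1, ha2⟩
    refine ⟨SMulMemClass.smul_mem c ha1, fun y hy => ?_⟩
    rw [smul_mul_assoc, lamE_smul J lam c (J.mul_mem (hs ha1) (hs hy)), ha2 y hy, mul_zero]
  mul_mem' := by
    rintro a b ⟨ha1, ha2⟩ ⟨hb1, hb2⟩
    refine ⟨mul_mem ha1 hb1, fun y hy => ?_⟩
    rw [mul_assoc]
    exact ha2 (b * y) (mul_mem hb1 hy)

theorem lStep_le (J : NonUnitalSubalgebra F R) (lam : ↥J →ₗ[F] F)
    (s : NonUnitalSubalgebra F R) (hs : s ≤ J) : lStep J lam s hs ≤ s :=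
  fun _ hx => hx.1

/-- The left kernel `𝔰` of the bilinear form `(X,Y) ↦ λ(XY)` restricted to `s × 𝔩`. -/
def sStep (J : NonUnitalSubalgebra F R) (lam : ↥J →ₗ[F] F)
    (s : NonUnitalSubalgebra F R) (hs : s ≤ J) : NonUnitalSubalgebra F R where
  carrier := {x | x ∈ s ∧ ∀ y ∈ lStep J lam s hs, lamE J lam (x * y) = 0}
  zero_mem' := ⟨zero_mem s, fun y _ => by rw [zero_mul, lamE_zero]⟩
  add_mem' := by
    rintro a b ⟨ha1, ha2⟩ ⟨hb1, hb2⟩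
    refine ⟨add_mem ha1 hb1, fun y hy => ?_⟩
    rw [add_mul, lamE_add J lam (J.mul_mem (hs ha1) (hs hy.1)) (J.mul_mem (hs hb1) (hs hy.1)),
      ha2 y hy, hb2 y hy, add_zero]
  smul_mem' := by
    rintro c a ⟨ha1, ha2⟩
    refine ⟨SMulMemClass.smul_mem c ha1, fun y hy => ?_⟩
    rw [smul_mul_assoc, lamE_smul J lam c (J.mul_mem (hs ha1) (hs hy.1)), ha2 y hy, mul_zero]
  mul_mem' := by
    rintro a b ⟨ha1, ha2⟩ ⟨hb1, hb2⟩
    refine ⟨mul_mem ha1 hb1, fun y hy => ?_⟩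
    rw [mul_assoc]
    refine ha2 (b * y) ⟨mul_mem hb1 hy.1, fun z hz => ?_⟩
    rw [mul_assoc]
    refine hb2 (y * z) ⟨mul_mem hy.1 hz, fun w hw => ?_⟩
    rw [mul_assoc]
    exact hy.2 (z * w) (mul_mem hz hw)

theorem sStep_le (J : NonUnitalSubalgebra F R) (lam : ↥J →ₗ[F] F)
    (s : NonUnitalSubalgebra F R) (hs : s ≤ J) : sStep J lam s hs ≤ s :=
  fun _ hx => hx.1

/-- `𝔩_λ`: the left kernel of `(X,Y) ↦ λ(XY)` on `J × J`. -/
def lone (J : NonUnitalSubalgebra F R) (lam : ↥J →ₗ[F] F) : NonUnitalSubalgebra F R :=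
  lStep J lam J le_rfl

/-- `𝔰_λ`: the left kernel of `(X,Y) ↦ λ(XY)` on `J × 𝔩_λ`. -/
def sone (J : NonUnitalSubalgebra F R) (lam : ↥J →ₗ[F] F) : NonUnitalSubalgebra F R :=
  sStep J lam J le_rfl

theorem lone_le (J : NonUnitalSubalgebra F R) (lam : ↥J →ₗ[F] F) : lone J lam ≤ J :=
  lStep_le J lam J le_rfl

theorem sone_le (J : NonUnitalSubalgebra F R) (lam : ↥J →ₗ[F] F) : sone J lam ≤ J :=
  sStep_le J lam J le_rfl

/-- `𝔨_λ = 𝔩_λ ∩ ker λ`. -/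
def kone (J : NonUnitalSubalgebra F R) (lam : ↥J →ₗ[F] F) : NonUnitalSubalgebra F R where
  carrier := {x | x ∈ lone J lam ∧ lamE J lam x = 0}
  zero_mem' := ⟨zero_mem _, lamE_zero J lam⟩
  add_mem' := by
    rintro a b ⟨ha1, ha2⟩ ⟨hb1, hb2⟩
    exact ⟨add_mem ha1 hb1, by
      rw [lamE_add J lam (lone_le J lam ha1) (lone_le J lam hb1), ha2, hb2, add_zero]⟩
  smul_mem' := by
    rintro c a ⟨ha1, ha2⟩
    exact ⟨SMulMemClass.smul_mem c ha1, by
      rw [lamE_smul J lam c (lone_le J lam ha1), ha2, mul_zero]⟩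
  mul_mem' := by
    rintro a b ⟨ha1, ha2⟩ ⟨hb1, hb2⟩
    exact ⟨mul_mem ha1 hb1, ha1.2 b (lone_le J lam hb1)⟩

theorem kone_le (J : NonUnitalSubalgebra F R) (lam : ↥J →ₗ[F] F) : kone J lam ≤ lone J lam :=
  fun _ hx => hx.1

/-- The descending chain `𝔰_λ^0 ⊇ 𝔰_λ^1 ⊇ ⋯` (bundled with the proof `𝔰_λ^i ≤ J`). -/
def sChainAux (J : NonUnitalSubalgebra F R) (lam : ↥J →ₗ[F] F) :
    ℕ → {s : NonUnitalSubalgebra F R // s ≤ J}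
  | 0 => ⟨J, le_rfl⟩
  | n + 1 =>
    ⟨sStep J lam (sChainAux J lam n).1 (sChainAux J lam n).2,
      le_trans (sStep_le J lam (sChainAux J lam n).1 (sChainAux J lam n).2)
        (sChainAux J lam n).2⟩

/-- `𝔰_λ^i`. -/
def sChain (J : NonUnitalSubalgebra F R) (lam : ↥J →ₗ[F] F) (i : ℕ) :
    NonUnitalSubalgebra F R :=
  (sChainAux J lam i).1

/-- `𝔩_λ^{i+1}`. -/
def lChain (J : NonUnitalSubalgebra F R) (lam : ↥J →ₗ[F] F) (i : ℕ) :
    NonUnitalSubalgebra F R :=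
  lStep J lam (sChainAux J lam i).1 (sChainAux J lam i).2

/-- The terminal element `𝔰̄_λ` of the descending chain; the chain has stabilized by
stage `|R|` since it is a weakly decreasing chain of subalgebras of the finite algebra. -/
def sbar (J : NonUnitalSubalgebra F R) (lam : ↥J →ₗ[F] F) : NonUnitalSubalgebra F R :=
  sChain J lam (Fintype.card R)

theorem sbar_le (J : NonUnitalSubalgebra F R) (lam : ↥J →ₗ[F] F) : sbar J lam ≤ J :=
  (sChainAux J lam (Fintype.card R)).2

/-- The terminal element `𝔩̄_λ` of the ascending chain. -/
def lbar (J : NonUnitalSubalgebra F R) (lam : ↥J →ₗ[F] F) : NonUnitalSubalgebra F R :=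
  lStep J lam (sbar J lam) (sbar_le J lam)

theorem lbar_le (J : NonUnitalSubalgebra F R) (lam : ↥J →ₗ[F] F) : lbar J lam ≤ J :=
  le_trans (lStep_le J lam _ _) (sbar_le J lam)

/-! ### Algebra subgroups of an algebra group -/

/-- The algebra subgroup `1 + k` of `1 + J`, as a subgroup of the ambient algebra group. -/
def algSubgroup (k J : NonUnitalSubalgebra F R) : Subgroup ↥(algGroup F R J) :=
  (algGroup F R k).subgroupOf (algGroup F R J)

/-- `L_λ = 1 + 𝔩_λ` as a subgroup of `G`. -/
def Lgrp (J : NonUnitalSubalgebra F R) (lam : ↥J →ₗ[F] F) : Subgroup ↥(algGroup F R J) :=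
  algSubgroup (lone J lam) J

/-- `S_λ = 1 + 𝔰_λ` as a subgroup of `G`. -/
def Sgrp (J : NonUnitalSubalgebra F R) (lam : ↥J →ₗ[F] F) : Subgroup ↥(algGroup F R J) :=
  algSubgroup (sone J lam) J

/-- `L̄_λ = 1 + 𝔩̄_λ` as a subgroup of `G`. -/
def Lbarg (J : NonUnitalSubalgebra F R) (lam : ↥J →ₗ[F] F) : Subgroup ↥(algGroup F R J) :=
  algSubgroup (lbar J lam) J

/-- `S̄_λ = 1 + 𝔰̄_λ` as a subgroup of `G`. -/
def Sbarg (J : NonUnitalSubalgebra F R) (lam : ↥J →ₗ[F] F) : Subgroup ↥(algGroup F R J) :=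
  algSubgroup (sbar J lam) J

/-- Passing from an element of the subgroup `1 + k ≤ 1 + J` to an element of the
algebra group `1 + k` in its own right. -/
def toAlg {k J : NonUnitalSubalgebra F R} (x : ↥(algSubgroup k J)) : ↥(algGroup F R k) :=
  ⟨((x : ↥(algGroup F R J)) : Rˣ), Subgroup.mem_subgroupOf.mp x.2⟩

/-- The linear inclusion of a smaller subalgebra. -/
def inclMap {s J : NonUnitalSubalgebra F R} (h : s ≤ J) : ↥s →ₗ[F] ↥J where
  toFun x := ⟨(x : R), h x.2⟩
  map_add' x y := rfl
  map_smul' c x := rfl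

/-- Restriction of a functional on `J` to a smaller subalgebra. -/
def resTo {s J : NonUnitalSubalgebra F R} (h : s ≤ J) (lam : ↥J →ₗ[F] F) : ↥s →ₗ[F] F :=
  lam.comp (inclMap h)

/-- The character `ξ_λ = Ind_{L̄_λ}^G (θ_λ)`. -/
def xi (θ : AddChar F ℂ) (J : NonUnitalSubalgebra F R) (lam : ↥J →ₗ[F] F) :
    ↥(algGroup F R J) → ℂ :=
  indFun (Lbarg J lam) (fun x => thetaFn θ J lam ↑x)

/-- The set `Ξ_λ = {g λ s g⁻¹ : g ∈ G, s ∈ S̄_λ}`. -/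
def Xi (J : NonUnitalSubalgebra F R) (lam : ↥J →ₗ[F] F) : Set (↥J →ₗ[F] F) :=
  {nu | ∃ g : ↥(algGroup F R J), ∃ s ∈ Sbarg J lam, nu = coAct g (rightAct s lam)}

/-! ### Normality of algebra subgroups coming from ideals -/

theorem conj_mem_aux (s a : NonUnitalSubalgebra F R)
    (hl : ∀ x ∈ s, ∀ y ∈ a, x * y ∈ a) (hr : ∀ y ∈ a, ∀ x ∈ s, y * x ∈ a)
    (u : Rˣ) (hu1 : (u : R) - 1 ∈ s) (hu2 : ((u⁻¹ : Rˣ) : R) - 1 ∈ s)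
    (x : Rˣ) (hx : (x : R) - 1 ∈ a) : ((u * x * u⁻¹ : Rˣ) : R) - 1 ∈ a := by
  have h1 : (u : R) * ((u⁻¹ : Rˣ) : R) = 1 := Units.mul_inv u
  have key : ((u * x * u⁻¹ : Rˣ) : R) - 1 =
      ((u : R) - 1) * ((x : R) - 1) * (((u⁻¹ : Rˣ) : R) - 1) +
        ((u : R) - 1) * ((x : R) - 1) + ((x : R) - 1) * (((u⁻¹ : Rˣ) : R) - 1) +
        ((x : R) - 1) := by
    push_cast
    calc (u : R) * (x : R) * ((u⁻¹ : Rˣ) : R) - 1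
        = (u : R) * (x : R) * ((u⁻¹ : Rˣ) : R) - (u : R) * ((u⁻¹ : Rˣ) : R) := by rw [h1]
      _ = _ := by noncomm_ring
  rw [key]
  exact add_mem (add_mem (add_mem (hr _ (hl _ hu1 _ hx) _ hu2) (hl _ hu1 _ hx))
    (hr _ hx _ hu2)) hx

theorem algSubgroup_normal (s a : NonUnitalSubalgebra F R)
    (hl : ∀ x ∈ s, ∀ y ∈ a, x * y ∈ a) (hr : ∀ y ∈ a, ∀ x ∈ s, y * x ∈ a) :
    ((algGroup F R a).subgroupOf (algGroup F R s)).Normal := by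
  constructor
  intro n hn g
  rw [Subgroup.mem_subgroupOf] at hn ⊢
  have hginv : ((g⁻¹ : ↥(algGroup F R s)) : Rˣ) = ((g : Rˣ))⁻¹ := rfl
  have hcoe : ((g * n * g⁻¹ : ↥(algGroup F R s)) : Rˣ) = (g : Rˣ) * (n : Rˣ) * ((g : Rˣ))⁻¹ := by
    push_cast [hginv]; rfl
  rw [mem_algGroup]
  constructor
  · rw [hcoe]
    exact conj_mem_aux s a hl hr (g : Rˣ) (g : ↥(algGroup F R s)).2.1 (g : ↥(algGroup F R s)).2.2
      (n : Rˣ) hn.1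
  · have hinv : (((g * n * g⁻¹ : ↥(algGroup F R s)) : Rˣ))⁻¹ =
        (g : Rˣ) * ((n : Rˣ))⁻¹ * ((g : Rˣ))⁻¹ := by
      rw [hcoe]; group
    rw [hinv]
    exact conj_mem_aux s a hl hr (g : Rˣ) (g : ↥(algGroup F R s)).2.1 (g : ↥(algGroup F R s)).2.2
      ((n : Rˣ))⁻¹ hn.2

theorem lone_mul_mem (J : NonUnitalSubalgebra F R) (lam : ↥J →ₗ[F] F)
    {y z : R} (hy : y ∈ lone J lam) (hz : z ∈ J) : y * z ∈ lone J lam := by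
  refine ⟨J.mul_mem (lone_le J lam hy) hz, fun w hw => ?_⟩
  rw [mul_assoc]
  exact hy.2 (z * w) (J.mul_mem hz hw)

theorem sone_mul_lone_mem (J : NonUnitalSubalgebra F R) (lam : ↥J →ₗ[F] F)
    {x y : R} (hx : x ∈ sone J lam) (hy : y ∈ lone J lam) : x * y ∈ lone J lam := by
  refine ⟨J.mul_mem (sone_le J lam hx) (lone_le J lam hy), fun w hw => ?_⟩
  rw [mul_assoc]
  exact hx.2 (y * w) (lone_mul_mem J lam hy hw)

theorem kone_ideal_left (J : NonUnitalSubalgebra F R) (lam : ↥J →ₗ[F] F) :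
    ∀ x ∈ sone J lam, ∀ y ∈ kone J lam, x * y ∈ kone J lam := by
  intro x hx y hy
  exact ⟨sone_mul_lone_mem J lam hx hy.1, hx.2 y hy.1⟩

theorem kone_ideal_right (J : NonUnitalSubalgebra F R) (lam : ↥J →ₗ[F] F) :
    ∀ y ∈ kone J lam, ∀ x ∈ sone J lam, y * x ∈ kone J lam := by
  intro y hy x hx
  exact ⟨lone_mul_mem J lam hy.1 (sone_le J lam hx), hy.1.2 x (sone_le J lam hx)⟩

/-- `K_λ = 1 + 𝔨_λ` as a (normal) subgroup of `S_λ = 1 + 𝔰_λ`. -/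
def KgrpIn (J : NonUnitalSubalgebra F R) (lam : ↥J →ₗ[F] F) :
    Subgroup ↥(algGroup F R (sone J lam)) :=
  (algGroup F R (kone J lam)).subgroupOf (algGroup F R (sone J lam))

instance KgrpIn_normal (J : NonUnitalSubalgebra F R) (lam : ↥J →ₗ[F] F) :
    (KgrpIn J lam).Normal :=
  algSubgroup_normal (sone J lam) (kone J lam) (kone_ideal_left J lam) (kone_ideal_right J lam)

/-- `L_λ = 1 + 𝔩_λ` as a (normal) subgroup of `S_λ = 1 + 𝔰_λ`. -/
def LgrpIn (J : NonUnitalSubalgebra F R) (lam : ↥J →ₗ[F] F) :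
    Subgroup ↥(algGroup F R (sone J lam)) :=
  (algGroup F R (lone J lam)).subgroupOf (algGroup F R (sone J lam))

instance LgrpIn_normal (J : NonUnitalSubalgebra F R) (lam : ↥J →ₗ[F] F) :
    (LgrpIn J lam).Normal :=
  algSubgroup_normal (sone J lam) (lone J lam)
    (fun x hx y hy => sone_mul_lone_mem J lam hx hy)
    (fun y hy x hx => lone_mul_mem J lam hy (sone_le J lam hx))

/-! ### Characters of finite groups -/

section Characters

open Representation

variable {G S : Type} [Group G] [Group S]

theorem innerG_eq_sum [Fintype G] (f h : G → ℂ) :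
    innerG G f h = (Nat.card G : ℂ)⁻¹ * ∑ x, f x * (starRingEnd ℂ) (h x) := by
  rw [innerG, finsum_eq_sum_of_fintype]

theorem isCharacter_character {V : Type} [AddCommGroup V] [Module ℂ V] [FiniteDimensional ℂ V]
    (ρ : Representation ℂ G V) : IsCharacter G ρ.character :=
  ⟨FDRep.of ρ, rfl⟩

theorem IsCharacter.exists_representation {f : G → ℂ} (hf : IsCharacter G f) :
    ∃ (V : Type) (_ : AddCommGroup V) (_ : Module ℂ V) (_ : FiniteDimensional ℂ V)
      (ρ : Representation ℂ G V), f = ρ.character := by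
  obtain ⟨V, rfl⟩ := hf
  exact ⟨V, inferInstance, inferInstance, inferInstance, V.ρ, rfl⟩

open Matrix in
/-- A finite group of complex matrices preserves a positive definite Hermitian form, so traces of
inverses are complex conjugates. -/
theorem trace_inv_eq_conj_of_finite [Fintype G] {n : Type} [Fintype n] [DecidableEq n]
    (A : G →* Matrix n n ℂ) (g : G) : (A g⁻¹).trace = (starRingEnd ℂ) (A g).trace := by
  set P : Matrix n n ℂ := ∑ x, (A x)ᴴ * A x with hP
  have hpos : P.PosDef := by
    have h1 : P = 1 + ∑ x ∈ Finset.univ.erase (1 : G), (A x)ᴴ * A x := by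
      rw [hP, ← Finset.add_sum_erase _ _ (Finset.mem_univ (1 : G))]
      simp
    rw [h1]
    exact Matrix.PosDef.one.add_posSemidef
      (Matrix.posSemidef_sum _ fun x _ => Matrix.posSemidef_conjTranspose_mul_self _)
  have hinv : (A g)ᴴ * P * A g = P := by
    rw [hP, Finset.mul_sum, Finset.sum_mul]
    refine Eq.trans (Finset.sum_congr rfl fun x _ => ?_)
      (Equiv.sum_comp (Equiv.mulRight g) fun x => (A x)ᴴ * A x)
    simp [Matrix.mul_assoc]
  have hu : IsUnit P.det := (Matrix.isUnit_iff_isUnit_det _).1 hpos.isUnit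
  have hg : A g * A g⁻¹ = 1 := by rw [← map_mul]; simp
  have h2 : (A g)ᴴ * P = P * A g⁻¹ := by
    calc (A g)ᴴ * P = (A g)ᴴ * P * (A g * A g⁻¹) := by rw [hg, Matrix.mul_one]
      _ = P * A g⁻¹ := by rw [← Matrix.mul_assoc, hinv]
  have h3 : A g⁻¹ = P⁻¹ * ((A g)ᴴ * P) := by
    rw [h2, Matrix.nonsing_inv_mul_cancel_left _ _ hu]
  rw [h3, Matrix.trace_mul_comm, Matrix.mul_assoc, Matrix.mul_nonsing_inv _ hu, Matrix.mul_one,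
    Matrix.trace_conjTranspose]
  rfl

theorem character_inv_eq_conj [Fintype G] {V : Type} [AddCommGroup V] [Module ℂ V]
    [FiniteDimensional ℂ V] (ρ : Representation ℂ G V) (g : G) :
    ρ.character g⁻¹ = (starRingEnd ℂ) (ρ.character g) := by
  let b := Module.finBasis ℂ V
  have := trace_inv_eq_conj_of_finite
    ((MonoidHomClass.toMonoidHom (LinearMap.toMatrixAlgEquiv b)).comp ρ) g
  simp only [character, LinearMap.trace_eq_matrix_trace ℂ b]
  exact this

theorem innerG_character [Fintype G] {V W : Type} [AddCommGroup V] [Module ℂ V]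
    [FiniteDimensional ℂ V] [AddCommGroup W] [Module ℂ W] [FiniteDimensional ℂ W]
    (σ : Representation ℂ G W) (ρ : Representation ℂ G V) :
    innerG G σ.character ρ.character = Module.finrank ℂ (IntertwiningMap ρ σ) := by
  have : Invertible (Nat.card G : ℂ) :=
    invertibleOfNonzero (Nat.cast_ne_zero.2 Nat.card_pos.ne')
  rw [innerG_eq_sum, ← card_inv_mul_sum_char_mul_char_eq_finrank]
  simp only [character_inv_eq_conj]

theorem character_mem_Irr [Fintype G] {V : Type} [AddCommGroup V] [Module ℂ V]
    [FiniteDimensional ℂ V] (ρ : Representation ℂ G V) [IsIrreducible ρ] :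
    ρ.character ∈ Irr G := by
  refine ⟨isCharacter_character ρ, ?_⟩
  rw [innerG_character, IsIrreducible.finrank_intertwiningMap_self, Nat.cast_one]

theorem eq_of_mem_Irr_of_innerG_ne_zero [Fintype G] {f h : G → ℂ} (hf : f ∈ Irr G)
    (hh : h ∈ Irr G) (hfh : innerG G f h ≠ 0) : f = h := by
  obtain ⟨⟨V, rfl⟩, hV⟩ := hf
  obtain ⟨⟨W, rfl⟩, hW⟩ := hh
  have hc : (Nat.card G : ℂ) ≠ 0 := Nat.cast_ne_zero.2 Nat.card_pos.ne'
  have : Invertible (Nat.card G : ℂ) := invertibleOfNonzero hc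
  have hconj : ∀ (U : FDRep ℂ G) (g : G), (starRingEnd ℂ) (U.character g) = U.character g⁻¹ :=
    fun U g => (character_inv_eq_conj U.ρ g).symm
  simp only [innerG_eq_sum, hconj] at hV hW hfh
  have hs : ∀ U : FDRep ℂ G,
      (Nat.card G : ℂ)⁻¹ * ∑ g, U.character g * U.character g⁻¹ = 1 →
      CategoryTheory.Simple U := fun U hU => by
    rw [FDRep.simple_iff_char_is_norm_one]
    rwa [inv_mul_eq_one₀ hc, eq_comm] at hU
  have := hs V hV
  have := hs W hW
  rw [FDRep.char_orthonormal] at hfh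
  have hi : Nonempty (V ≅ W) := by
    by_contra hn
    simp [hn] at hfh
  exact FDRep.char_iso hi.some

theorem IsCharacter.conj_invariant {f : G → ℂ} (hf : IsCharacter G f) (g h : G) :
    f (h * g * h⁻¹) = f g := by
  obtain ⟨V, rfl⟩ := hf
  exact V.char_conj g h

theorem IsCharacter.comp_hom {f : G → ℂ} (hf : IsCharacter G f) (φ : S →* G) :
    IsCharacter S (fun s => f (φ s)) := by
  obtain ⟨V, _, _, _, ρ, rfl⟩ := hf.exists_representation
  exact isCharacter_character (ρ.comp φ)

theorem exists_irreducible_intertwining [Fintype G] (n : ℕ) :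
    ∀ (V : Type) [AddCommGroup V] [Module ℂ V] [FiniteDimensional ℂ V] (ρ : Representation ℂ G V),
      Module.finrank ℂ V = n → Nontrivial V →
      ∃ (U : Type) (_ : AddCommGroup U) (_ : Module ℂ U) (_ : FiniteDimensional ℂ U)
        (σ : Representation ℂ G U) (_ : IsIrreducible σ) (f : IntertwiningMap σ ρ), f ≠ 0 := by
  induction n using Nat.strong_induction_on with
  | _ n ih =>
  intro V _ _ _ ρ hn hV
  by_cases hirr : IsIrreducible ρ
  · refine ⟨V, inferInstance, inferInstance, inferInstance, ρ, hirr,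
      LinearMap.intertwiningMap_of_isIntertwiningMap ρ ρ LinearMap.id fun _ _ => rfl, ?_⟩
    intro h
    obtain ⟨v, hv⟩ := exists_ne (0 : V)
    exact hv (congrArg (fun f : IntertwiningMap ρ ρ => f.toLinearMap v) h)
  · have hnt : Nontrivial (Subrepresentation ρ) := by
      refine ⟨⊥, ⊤, fun h => ?_⟩
      obtain ⟨v, hv⟩ := exists_ne (0 : V)
      have hm : v ∈ (⊤ : Submodule ℂ V) := trivial
      have h' : (⊥ : Submodule ℂ V) = ⊤ := congrArg Subrepresentation.toSubmodule h
      rw [← h'] at hm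
      exact hv ((Submodule.mem_bot ℂ).1 hm)
    obtain ⟨W, hW0, hW1⟩ : ∃ W : Subrepresentation ρ, W ≠ ⊥ ∧ W ≠ ⊤ := by
      by_contra! hcon
      exact hirr ⟨fun W => or_iff_not_imp_left.2 (hcon W)⟩
    have hlt : Module.finrank ℂ W.toSubmodule < n := by
      rw [← hn]
      exact Submodule.finrank_lt fun h => hW1 (Subrepresentation.toSubmodule_injective h)
    have hWn : Nontrivial W.toSubmodule :=
      (Submodule.nontrivial_iff_ne_bot).2
        fun h => hW0 (Subrepresentation.toSubmodule_injective h)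
    obtain ⟨U, _, _, _, σ, hσ, f, hf⟩ := ih _ hlt W.toSubmodule W.toRepresentation rfl hWn
    refine ⟨U, inferInstance, inferInstance, inferInstance, σ, hσ,
      LinearMap.intertwiningMap_of_isIntertwiningMap σ ρ
        (W.toSubmodule.subtype ∘ₗ f.toLinearMap) fun g v => ?_, ?_⟩
    · have := LinearMap.congr_fun (f.isIntertwining' g) v
      simp only [LinearMap.comp_apply] at this ⊢
      rw [this]; rfl
    · intro h
      apply hf
      ext v
      exact congrArg (fun k : IntertwiningMap σ ρ => k.toLinearMap v) h

end Characters
/-! ### Induction along a homomorphism of finite groups -/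

section Induction

open Representation

variable {G S : Type} [Group G] [Group S] [Fintype G] [Fintype S]

/-- The function on `G` induced from a function on `S` along `ι : S →* G`. -/
def indAlong (ι : S →* G) (f : S → ℂ) (g : G) : ℂ :=
  (Nat.card S : ℂ)⁻¹ * ∑ x : G, ∑ s : S, if ι s = x * g * x⁻¹ then f s else 0

theorem trace_pi_eq_sum {κ V : Type} [Fintype κ] [AddCommGroup V] [Module ℂ V]
    [FiniteDimensional ℂ V] (T : (κ → V) →ₗ[ℂ] (κ → V)) :
    LinearMap.trace ℂ (κ → V) T =
      ∑ x, LinearMap.trace ℂ V (LinearMap.proj x ∘ₗ T ∘ₗ LinearMap.single ℂ (fun _ => V) x) := by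
  let b := Module.finBasis ℂ V
  rw [LinearMap.trace_eq_matrix_trace ℂ (Pi.basis fun _ : κ => b)]
  simp only [LinearMap.trace_eq_matrix_trace ℂ b, Matrix.trace, Matrix.diag_apply,
    LinearMap.toMatrix_apply]
  rw [Fintype.sum_sigma]
  simp

/-- The right translation action of `G` on functions `G → V`. -/
def rightRegular (G V : Type) [Group G] [AddCommGroup V] [Module ℂ V] :
    Representation ℂ G (G → V) where
  toFun g := LinearMap.funLeft ℂ V (· * g)
  map_one' := by ext; simp [LinearMap.funLeft]
  map_mul' g h := by ext; simp [LinearMap.funLeft, mul_assoc]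

theorem rightRegular_apply {V : Type} [AddCommGroup V] [Module ℂ V] (g : G) (u : G → V) (x : G) :
    rightRegular G V g u x = u (x * g) := rfl

variable {V : Type} [AddCommGroup V] [Module ℂ V]

/-- The induced representation, realized on the `S`-equivariant functions `G → V`. -/
def equivariantFunctions (ι : S →* G) (ρ : Representation ℂ S V) :
    Subrepresentation (rightRegular G V) where
  toSubmodule :=
    { carrier := {u | ∀ s x, u (ι s * x) = ρ s (u x)}
      zero_mem' := fun s x => by simp
      add_mem' := fun {u v} hu hv s x => by simp [hu s x, hv s x]
      smul_mem' := fun c u hu s x => by simp [hu s x] }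
  apply_mem_toSubmodule := fun g u hu s x => by
    simp only [rightRegular_apply, mul_assoc]
    exact hu s (x * g)

/-- The averaging projection of `G → V` onto the `S`-equivariant functions. -/
def equivariantAverage (ι : S →* G) (ρ : Representation ℂ S V) : (G → V) →ₗ[ℂ] (G → V) :=
  (Nat.card S : ℂ)⁻¹ • ∑ s : S, LinearMap.pi fun x => ρ s⁻¹ ∘ₗ LinearMap.proj (ι s * x)

theorem equivariantAverage_apply (ι : S →* G) (ρ : Representation ℂ S V) (u : G → V) (x : G) :
    equivariantAverage ι ρ u x = (Nat.card S : ℂ)⁻¹ • ∑ s : S, ρ s⁻¹ (u (ι s * x)) := by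
  simp [equivariantAverage, LinearMap.sum_apply, Finset.sum_apply]

theorem equivariantAverage_mem (ι : S →* G) (ρ : Representation ℂ S V) (u : G → V) :
    equivariantAverage ι ρ u ∈ (equivariantFunctions ι ρ).toSubmodule := by
  intro r x
  simp only [equivariantAverage_apply, map_smul, map_sum]
  congr 1
  rw [← Equiv.sum_comp (Equiv.mulRight r) (fun s => ρ r (ρ s⁻¹ (u (ι s * x))))]
  refine Finset.sum_congr rfl fun s _ => ?_
  simp only [Equiv.coe_mulRight, mul_inv_rev, map_mul, ← Module.End.mul_apply, ← mul_assoc]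
  rw [← map_mul ρ r, mul_inv_cancel, map_one, one_mul]

theorem equivariantAverage_of_mem (ι : S →* G) (ρ : Representation ℂ S V) (u : G → V)
    (hu : u ∈ (equivariantFunctions ι ρ).toSubmodule) : equivariantAverage ι ρ u = u := by
  have hu' : ∀ s x, u (ι s * x) = ρ s (u x) := hu
  ext x
  rw [equivariantAverage_apply]
  simp only [hu', ← Module.End.mul_apply, ← map_mul, inv_mul_cancel, map_one, Module.End.one_apply]
  simp only [Finset.sum_const, Finset.card_univ, ← Nat.card_eq_fintype_card]
  rw [← Nat.cast_smul_eq_nsmul ℂ, smul_smul,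
    inv_mul_cancel₀ (Nat.cast_ne_zero.2 Nat.card_pos.ne'), one_smul]

theorem IsCharacter.indAlong {f : S → ℂ} (hf : IsCharacter S f) (ι : S →* G) :
    IsCharacter G (indAlong ι f) := by
  obtain ⟨V, _, _, _, ρ, rfl⟩ := hf.exists_representation
  convert isCharacter_character (equivariantFunctions ι ρ).toRepresentation using 1
  ext g
  set T : (G → V) →ₗ[ℂ] (G → V) := rightRegular G V g ∘ₗ equivariantAverage ι ρ with hT
  have hmem : ∀ u, T u ∈ (equivariantFunctions ι ρ).toSubmodule := fun u =>
    (equivariantFunctions ι ρ).apply_mem_toSubmodule g (equivariantAverage_mem ι ρ u)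
  have hrestr : (equivariantFunctions ι ρ).toRepresentation g = T.restrict fun u _ => hmem u := by
    ext1 u
    apply Subtype.ext
    change rightRegular G V g u = rightRegular G V g (equivariantAverage ι ρ u)
    rw [equivariantAverage_of_mem ι ρ u u.2]
  rw [character, hrestr, LinearMap.trace_restrict_eq_of_forall_mem _ _ hmem, trace_pi_eq_sum,
    IterChar.indAlong, Finset.mul_sum]
  refine Finset.sum_congr rfl fun x _ => ?_
  have hblock : LinearMap.proj x ∘ₗ T ∘ₗ LinearMap.single ℂ (fun _ => V) x =
      (Nat.card S : ℂ)⁻¹ • ∑ s : S, if ι s = x * g * x⁻¹ then ρ s else 0 := by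
    ext1 v
    simp only [hT, LinearMap.comp_apply, LinearMap.proj_apply, rightRegular_apply,
      equivariantAverage_apply, LinearMap.smul_apply, LinearMap.sum_apply]
    congr 1
    rw [← Equiv.sum_comp (Equiv.inv S)]
    refine Finset.sum_congr rfl fun s _ => ?_
    have hiff : ι s⁻¹ * (x * g) = x ↔ ι s = x * g * x⁻¹ := by
      rw [map_inv, inv_mul_eq_iff_eq_mul, eq_mul_inv_iff_mul_eq, eq_comm]
    by_cases h : ι s = x * g * x⁻¹
    · rw [if_pos h]
      simp only [Equiv.inv_apply, hiff.2 h, inv_inv, LinearMap.coe_single, Pi.single_eq_same]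
    · have h' : ι s⁻¹ * (x * g) ≠ x := fun hh => h (hiff.1 hh)
      rw [if_neg h]
      simp only [Equiv.inv_apply, inv_inv, LinearMap.coe_single, Pi.single_eq_of_ne h', map_zero,
        LinearMap.zero_apply]
  rw [hblock, map_smul, map_sum, smul_eq_mul]
  congr 1
  refine Finset.sum_congr rfl fun s _ => ?_
  split_ifs
  · rfl
  · simp

theorem indAlong_one (ι : S →* G) (hι : Function.Injective ι) (f : S → ℂ) :
    indAlong ι f 1 = (Nat.card G : ℂ) / Nat.card S * f 1 := by
  have h : ∀ s : S, (ι s = 1) = (s = 1) := fun s => by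
    rw [eq_iff_iff, ← map_one ι]; exact hι.eq_iff
  simp only [indAlong, mul_one, mul_inv_cancel, h, Finset.sum_ite_eq', Finset.mem_univ, if_true,
    Finset.sum_const, Finset.card_univ, nsmul_eq_mul, ← Nat.card_eq_fintype_card]
  ring

theorem innerG_indAlong (ι : S →* G) (f : S → ℂ) (h : G → ℂ)
    (hh : ∀ g x, h (x * g * x⁻¹) = h g) :
    innerG G (indAlong ι f) h = innerG S f (fun s => h (ι s)) := by
  have hG : (Nat.card G : ℂ) ≠ 0 := Nat.cast_ne_zero.2 Nat.card_pos.ne'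
  have key : ∑ g : G, (∑ x : G, ∑ s : S, if ι s = x * g * x⁻¹ then f s else 0) *
      (starRingEnd ℂ) (h g) = (Nat.card G : ℂ) * ∑ s, f s * (starRingEnd ℂ) (h (ι s)) := by
    simp only [Finset.sum_mul]
    rw [Finset.sum_comm]
    have : ∀ x : G, ∑ g : G, ∑ s : S, (if ι s = x * g * x⁻¹ then f s else 0) *
        (starRingEnd ℂ) (h g) = ∑ s, f s * (starRingEnd ℂ) (h (ι s)) := fun x => by
      rw [Finset.sum_comm]
      refine Finset.sum_congr rfl fun s _ => ?_
      have hiff : ∀ g, (ι s = x * g * x⁻¹) = (g = x⁻¹ * ι s * x) := fun g => by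
        rw [eq_iff_iff]
        constructor
        · intro e; rw [e]; group
        · intro e; rw [e]; group
      simp only [hiff, ite_mul, zero_mul, Finset.sum_ite_eq', Finset.mem_univ, if_true]
      congr 2
      simpa using hh (ι s) x⁻¹
    rw [Finset.sum_congr rfl fun x _ => this x]
    simp
  simp only [innerG_eq_sum, indAlong, mul_assoc (Nat.card S : ℂ)⁻¹, ← Finset.mul_sum]
  rw [key]
  field_simp

theorem indAlong_conj (ι : S →* G) (f : S → ℂ) (g y : G) :
    indAlong ι f (y * g * y⁻¹) = indAlong ι f g := by
  rw [indAlong, indAlong, ← Equiv.sum_comp (Equiv.mulRight y)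
    (fun x => ∑ s : S, if ι s = x * g * x⁻¹ then f s else 0)]
  simp [mul_assoc]

theorem innerG_comm (f h : G → ℂ) : innerG G h f = (starRingEnd ℂ) (innerG G f h) := by
  simp [innerG_eq_sum, mul_comm]

end Induction
/-! ### Characters above an invariant linear character of a normal subgroup -/

section Invariant

open Representation

variable {G S : Type} [Group G] [Group S] [Fintype G] [Fintype S]

/-- The function `t` restricts to an `S`-invariant unitary linear character of `L`. -/
structure IsInvariantLinear (L : Subgroup S) (t : S → ℂ) : Prop where
  one : t 1 = 1
  mul : ∀ l ∈ L, ∀ l' ∈ L, t (l * l') = t l * t l'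
  inv : ∀ l ∈ L, t l⁻¹ = (starRingEnd ℂ) (t l)
  conj : ∀ l ∈ L, ∀ s, t (s * l * s⁻¹) = t l

variable {L : Subgroup S} {t : S → ℂ}

theorem IsInvariantLinear.inv_mul (ht : IsInvariantLinear L t) {l : S} (hl : l ∈ L) :
    t l⁻¹ * t l = 1 := by
  rw [← ht.mul _ (inv_mem hl) _ hl, inv_mul_cancel, ht.one]

theorem IsInvariantLinear.ne_zero (ht : IsInvariantLinear L t) {l : S} (hl : l ∈ L) :
    t l ≠ 0 := right_ne_zero_of_mul_eq_one (ht.inv_mul hl)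

variable {V : Type} [AddCommGroup V] [Module ℂ V]

/-- The restriction of `ρ` to `L`, tensored with the inverse of the linear character `t`. -/
def twist (ht : IsInvariantLinear L t) (ρ : Representation ℂ S V) : Representation ℂ L V where
  toFun l := t (l : S)⁻¹ • ρ (l : S)
  map_one' := by simp [ht.one]
  map_mul' l l' := by
    rw [Subgroup.coe_mul, mul_inv_rev, ht.mul _ (inv_mem l'.2) _ (inv_mem l.2), map_mul,
      smul_mul_smul_comm, mul_comm (t _)]

theorem twist_apply (ht : IsInvariantLinear L t) (ρ : Representation ℂ S V) (l : L) (v : V) :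
    twist ht ρ l v = t (l : S)⁻¹ • ρ (l : S) v := rfl

theorem mem_invariants_twist (ht : IsInvariantLinear L t) (ρ : Representation ℂ S V) (v : V) :
    v ∈ invariants (twist ht ρ) ↔ ∀ l ∈ L, ρ l v = t l • v := by
  simp only [mem_invariants, twist_apply, Subtype.forall]
  refine forall₂_congr fun l hl => ?_
  have h := ht.inv_mul hl
  constructor
  · intro e
    rw [← e, smul_smul, mul_comm, h, one_smul, e]
  · intro e
    rw [e, smul_smul, h, one_smul]

theorem twist_character [FiniteDimensional ℂ V] (ht : IsInvariantLinear L t)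
    (ρ : Representation ℂ S V) (l : L) :
    (twist ht ρ).character l = t (l : S)⁻¹ * ρ.character l := by
  simp [character, twist]

theorem sum_twist_eq_finrank [FiniteDimensional ℂ V] (ht : IsInvariantLinear L t)
    (ρ : Representation ℂ S V) :
    (Nat.card L : ℂ)⁻¹ * ∑ l : L, t (l : S)⁻¹ * ρ.character l =
      Module.finrank ℂ (invariants (twist ht ρ)) := by
  have : Invertible (Nat.card L : ℂ) :=
    invertibleOfNonzero (Nat.cast_ne_zero.2 Nat.card_pos.ne')
  rw [← card_inv_mul_sum_char_eq_finrank]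
  simp only [twist_character]

theorem apply_eq_smul_of_character_eq [FiniteDimensional ℂ V] (ht : IsInvariantLinear L t)
    (ρ : Representation ℂ S V) (h : ∀ l ∈ L, ρ.character l = ρ.character 1 * t l) :
    ∀ l ∈ L, ρ l = t l • LinearMap.id := by
  have hc : (Nat.card L : ℂ) ≠ 0 := Nat.cast_ne_zero.2 Nat.card_pos.ne'
  have hsum := sum_twist_eq_finrank ht ρ
  have : ∀ l : L, t (l : S)⁻¹ * ρ.character l = ρ.character 1 := fun l => by
    rw [h l l.2, mul_left_comm, ht.inv_mul l.2, mul_one]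
  simp only [this, Finset.sum_const, Finset.card_univ, nsmul_eq_mul,
    ← Nat.card_eq_fintype_card, char_one] at hsum
  rw [inv_mul_cancel_left₀ hc, Nat.cast_inj] at hsum
  have htop := Submodule.eq_top_of_finrank_eq hsum.symm
  intro l hl
  ext v
  have hv : v ∈ invariants (twist ht ρ) := htop ▸ Submodule.mem_top
  exact (mem_invariants_twist ht ρ v).1 hv l hl

theorem IsCharacter.mul_of_mem {ψ : S → ℂ} (hψ : IsCharacter S ψ) (ht : IsInvariantLinear L t)
    (h : ∀ l ∈ L, ψ l = ψ 1 * t l) : ∀ s, ∀ l ∈ L, ψ (s * l) = ψ s * t l := by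
  obtain ⟨V, _, _, _, ρ, rfl⟩ := hψ.exists_representation
  intro s l hl
  have h1 := apply_eq_smul_of_character_eq ht ρ h l hl
  rw [character, map_mul, h1, mul_smul_comm, map_smul, smul_eq_mul, mul_comm]
  rfl

/-- The subrepresentation on which the normal subgroup `L` acts through `t`. -/
def isotypicSub [L.Normal] (ht : IsInvariantLinear L t) (ρ : Representation ℂ S V) :
    Subrepresentation ρ where
  toSubmodule := invariants (twist ht ρ)
  apply_mem_toSubmodule s v hv := by
    rw [mem_invariants_twist] at hv ⊢
    intro l hl
    have hl' : s⁻¹ * l * s ∈ L := by simpa using Subgroup.Normal.conj_mem ‹_› l hl s⁻¹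
    have h1 : l * s = s * (s⁻¹ * l * s) := by group
    have h2 : t (s⁻¹ * l * s) = t l := by simpa using ht.conj l hl s⁻¹
    rw [← Module.End.mul_apply, ← map_mul, h1, map_mul, Module.End.mul_apply, hv _ hl', map_smul,
      h2]

theorem exists_mem_Irr_above [L.Normal] (ht : IsInvariantLinear L t) {χ : S → ℂ}
    (hχ : IsCharacter S χ) (h : ∑ l : L, t l * (starRingEnd ℂ) (χ l) ≠ 0) :
    ∃ ψ ∈ Irr S, (∀ l ∈ L, ψ l = ψ 1 * t l) ∧ innerG S ψ χ ≠ 0 := by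
  obtain ⟨V, _, _, _, ρ, rfl⟩ := hχ.exists_representation
  have hc : (Nat.card L : ℂ) ≠ 0 := Nat.cast_ne_zero.2 Nat.card_pos.ne'
  have hsum : ∑ l : L, t (l : S)⁻¹ * ρ.character l ≠ 0 := by
    intro h0
    apply h
    have := congrArg (starRingEnd ℂ) h0
    simp only [map_sum, map_mul, map_zero] at this
    rw [← this]
    refine Finset.sum_congr rfl fun l _ => ?_
    rw [ht.inv _ l.2, starRingEnd_self_apply]
  have hfin : Module.finrank ℂ (invariants (twist ht ρ)) ≠ 0 := by
    intro h0
    have := sum_twist_eq_finrank ht ρ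
    rw [h0, Nat.cast_zero] at this
    exact hsum ((mul_eq_zero.1 this).resolve_left (inv_ne_zero hc))
  have hnt : Nontrivial (invariants (twist ht ρ)) :=
    Module.nontrivial_of_finrank_pos (R := ℂ) (Nat.pos_of_ne_zero hfin)
  obtain ⟨U, _, _, _, σ, hσ, f, hf⟩ := exists_irreducible_intertwining _ _
    (isotypicSub ht ρ).toRepresentation rfl hnt
  have hinj : Function.Injective f := (IsIrreducible.injective_or_eq_zero f).resolve_right hf
  have h_comm : ∀ s u, f (σ s u) = (isotypicSub ht ρ).toRepresentation s (f u) := fun s u =>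
    LinearMap.congr_fun (f.isIntertwining' s) u
  have hscal : ∀ l ∈ L, σ l = t l • LinearMap.id := by
    intro l hl
    ext u
    apply hinj
    rw [h_comm]
    apply Subtype.ext
    have h1 := (mem_invariants_twist ht ρ (f u : V)).1 (f u).2 l hl
    have h2 : f ((t l • LinearMap.id : U →ₗ[ℂ] U) u) = t l • f u := f.toLinearMap.map_smul _ _
    rw [h2]
    exact h1
  refine ⟨σ.character, character_mem_Irr σ, fun l hl => ?_, ?_⟩
  · rw [character, hscal l hl, char_one, map_smul, smul_eq_mul, mul_comm, LinearMap.trace_id]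
  · rw [innerG_comm, ← map_zero (starRingEnd ℂ), (starRingEnd ℂ).injective.ne_iff,
      innerG_character, Nat.cast_ne_zero]
    let f' : IntertwiningMap σ ρ := LinearMap.intertwiningMap_of_isIntertwiningMap σ ρ
      ((isotypicSub ht ρ).toSubmodule.subtype ∘ₗ f.toLinearMap) fun s u =>
        congrArg Subtype.val (h_comm s u)
    have hf' : f' ≠ 0 := by
      intro h0
      apply hf
      ext u
      exact congrArg (fun k : IntertwiningMap σ ρ => k.toLinearMap u) h0
    have : Module.Finite ℂ (IntertwiningMap σ ρ) :=
      Module.Finite.equiv (invariantsEquivIntertwiningMap σ ρ)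
    have : Nontrivial (IntertwiningMap σ ρ) := ⟨f', 0, hf'⟩
    exact Module.finrank_pos.ne'

/-- Induction is isometric on class functions lying above `t` as soon as no element outside
the image of `ι` intertwines `t` with its conjugate. -/
theorem innerG_indAlong_indAlong (ι : S →* G) (hι : Function.Injective ι)
    (ht : IsInvariantLinear L t)
    (hM : ∀ x ∉ ι.range, ∃ l ∈ L, ∃ l' ∈ L, ι l' = x * ι l * x⁻¹ ∧ t l ≠ t l')
    {a b : S → ℂ} (ha : ∀ s, ∀ l ∈ L, a (s * l) = a s * t l)
    (hb : ∀ s, ∀ l ∈ L, b (s * l) = b s * t l) (hbc : ∀ s r, b (r * s * r⁻¹) = b s) :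
    innerG G (indAlong ι a) (indAlong ι b) = innerG S a b := by
  rw [innerG_indAlong _ _ _ fun g x => indAlong_conj ι b g x]
  set M : G → ℂ := fun x => ∑ s : S, ∑ s' : S,
    if ι s' = x * ι s * x⁻¹ then a s * (starRingEnd ℂ) (b s') else 0 with hMdef
  have hout : ∀ x ∉ ι.range, M x = 0 := by
    intro x hx
    obtain ⟨l, hl, l', hl', e, hne⟩ := hM x hx
    have hiff : ∀ s s', (ι (s' * l') = x * ι (s * l) * x⁻¹) = (ι s' = x * ι s * x⁻¹) := by
      intro s s'
      have h1 : x * ι (s * l) * x⁻¹ = (x * ι s * x⁻¹) * ι l' := by rw [e, map_mul]; group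
      rw [h1, map_mul, mul_left_inj]
    have h1 : M x = (t l * (starRingEnd ℂ) (t l')) * M x := by
      conv_lhs => rw [hMdef]
      simp only
      rw [← Equiv.sum_comp (Equiv.mulRight l), hMdef, Finset.mul_sum]
      refine Finset.sum_congr rfl fun s _ => ?_
      rw [← Equiv.sum_comp (Equiv.mulRight l'), Finset.mul_sum]
      refine Finset.sum_congr rfl fun s' _ => ?_
      simp only [Equiv.coe_mulRight, hiff, ha _ _ hl, hb _ _ hl']
      split_ifs
      · rw [map_mul]; ring
      · simp
    by_contra h0
    have h2 : t l * (starRingEnd ℂ) (t l') = 1 := by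
      have := mul_right_cancel₀ h0 ((one_mul (M x)).trans h1)
      exact this.symm
    rw [← ht.inv _ hl'] at h2
    apply hne
    calc t l = t l * (t l'⁻¹ * t l') := by rw [ht.inv_mul hl', mul_one]
      _ = t l' := by rw [← mul_assoc, h2, one_mul]
  have hin : ∀ r : S, M (ι r) = ∑ s, a s * (starRingEnd ℂ) (b s) := by
    intro r
    refine Finset.sum_congr rfl fun s _ => ?_
    have hiff : ∀ s', (ι s' = ι r * ι s * (ι r)⁻¹) = (s' = r * s * r⁻¹) := fun s' => by
      rw [← map_inv, ← map_mul, ← map_mul, eq_iff_iff]; exact hι.eq_iff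
    simp only [hiff, Finset.sum_ite_eq', Finset.mem_univ, if_true, hbc]
  have hsum : ∑ x, M x = (Nat.card S : ℂ) * ∑ s, a s * (starRingEnd ℂ) (b s) := by
    have h1 : ∑ x, M x = ∑ r : S, M (ι r) := by
      symm
      rw [← Finset.sum_image (s := Finset.univ) (g := ι) (f := M) (fun r _ r' _ h => hι h)]
      refine Finset.sum_subset (Finset.subset_univ _) fun x _ hx => hout x ?_
      rintro ⟨r, rfl⟩
      exact hx (Finset.mem_image_of_mem _ (Finset.mem_univ r))
    rw [h1, Finset.sum_congr rfl fun r _ => hin r]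
    simp
  have hS : (Nat.card S : ℂ) ≠ 0 := Nat.cast_ne_zero.2 Nat.card_pos.ne'
  have hexp : ∑ s, a s * (starRingEnd ℂ) (indAlong ι b (ι s)) =
      (Nat.card S : ℂ)⁻¹ * ∑ x, M x := by
    simp only [indAlong, map_mul, map_sum, map_inv₀, map_natCast, hMdef]
    rw [Finset.sum_comm, Finset.mul_sum]
    refine Finset.sum_congr rfl fun s _ => ?_
    rw [mul_left_comm, Finset.mul_sum]
    congr 1
    refine Finset.sum_congr rfl fun x _ => ?_
    rw [Finset.mul_sum]
    refine Finset.sum_congr rfl fun s' _ => ?_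
    split_ifs
    · rfl
    · simp
  rw [innerG_eq_sum, innerG_eq_sum, hexp, hsum, inv_mul_cancel_left₀ hS]

/-- The character of `S` induced from the linear character `t` of `L`. -/
def linearInd (L : Subgroup S) (t : S → ℂ) (s : S) : ℂ :=
  if s ∈ L then (Nat.card S : ℂ) / Nat.card L * t s else 0

theorem linearInd_mul_of_mem (ht : IsInvariantLinear L t) (s l : S) (hl : l ∈ L) :
    linearInd L t (s * l) = linearInd L t s * t l := by
  unfold linearInd
  by_cases hs : s ∈ L
  · rw [if_pos hs, if_pos (mul_mem hs hl), ht.mul _ hs _ hl, mul_assoc]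
  · rw [if_neg hs, if_neg (by rwa [Subgroup.mul_mem_cancel_right _ hl]), zero_mul]

theorem innerG_linearInd (h : S → ℂ) :
    innerG S (linearInd L t) h =
      (Nat.card L : ℂ)⁻¹ * ∑ l : L, t l * (starRingEnd ℂ) (h l) := by
  have hS : (Nat.card S : ℂ) ≠ 0 := Nat.cast_ne_zero.2 Nat.card_pos.ne'
  have h1 : ∑ l : L, t l * (starRingEnd ℂ) (h l) =
      ∑ s : S, if s ∈ L then t s * (starRingEnd ℂ) (h s) else 0 := by
    rw [← Finset.sum_filter]
    exact (Finset.sum_subtype (p := (· ∈ L)) _ (by simp)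
      (fun s => t s * (starRingEnd ℂ) (h s))).symm
  rw [innerG_eq_sum, h1, Finset.mul_sum, Finset.mul_sum]
  refine Finset.sum_congr rfl fun s _ => ?_
  unfold linearInd
  split_ifs
  · field_simp
  · simp

theorem innerG_quotient (K : Subgroup S) [K.Normal] (f h : S ⧸ K → ℂ) :
    innerG (S ⧸ K) f h = innerG S (fun s => f (QuotientGroup.mk s))
      (fun s => h (QuotientGroup.mk s)) := by
  have hK : (Nat.card K : ℂ) ≠ 0 := Nat.cast_ne_zero.2 Nat.card_pos.ne'
  have hS : (Nat.card S : ℂ) = Nat.card (S ⧸ K) * Nat.card K := by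
    rw [Subgroup.card_eq_card_quotient_mul_card_subgroup K, Nat.cast_mul]
  have hsum : ∑ s : S, f (QuotientGroup.mk s) * (starRingEnd ℂ) (h (QuotientGroup.mk s)) =
      Nat.card K * ∑ x : S ⧸ K, f x * (starRingEnd ℂ) (h x) := by
    rw [← Equiv.sum_comp (Subgroup.groupEquivQuotientProdSubgroup (s := K)).symm, Fintype.sum_prod_type,
      Finset.mul_sum]
    refine Finset.sum_congr rfl fun x _ => ?_
    have : ∀ k : K, (QuotientGroup.mk ((Subgroup.groupEquivQuotientProdSubgroup (s := K)).symm (x, k)) :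
        S ⧸ K) = x := fun k => by
      have h1 := Equiv.apply_symm_apply
        (Subgroup.groupEquivQuotientProdSubgroup (s := K)) (x, k)
      exact congrArg Prod.fst h1
    simp only [this, Finset.sum_const, Finset.card_univ, nsmul_eq_mul, Nat.card_eq_fintype_card]
  rw [innerG_eq_sum, innerG_eq_sum, hsum, hS, mul_inv, mul_assoc, inv_mul_cancel_left₀ hK]

theorem IsCharacter.exists_quotient {ψ : S → ℂ} (hψ : IsCharacter S ψ)
    (ht : IsInvariantLinear L t) (h : ∀ l ∈ L, ψ l = ψ 1 * t l) (K : Subgroup S) [K.Normal]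
    (hKL : K ≤ L) (htK : ∀ k ∈ K, t k = 1) :
    ∃ ψ' : S ⧸ K → ℂ, IsCharacter (S ⧸ K) ψ' ∧ ∀ s : S, ψ' (QuotientGroup.mk s) = ψ s := by
  obtain ⟨V, _, _, _, ρ, rfl⟩ := hψ.exists_representation
  have hk : ∀ k ∈ K, ρ k = 1 := fun k hk => by
    rw [apply_eq_smul_of_character_eq ht ρ h k (hKL hk), htK k hk, one_smul]; rfl
  exact ⟨_, isCharacter_character (V := V) (QuotientGroup.lift K ρ hk), fun s => rfl⟩

theorem one_pos_of_mem_Irr {f : G → ℂ} (hf : f ∈ Irr G) : 0 < f 1 := by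
  obtain ⟨hc, h1⟩ := hf
  obtain ⟨V, _, _, _, ρ, rfl⟩ := hc.exists_representation
  rw [char_one]
  refine Nat.cast_pos.2 (Nat.pos_of_ne_zero fun h0 => ?_)
  have := Module.finrank_zero_iff.1 h0
  have hz : ∀ g, ρ.character g = 0 := fun g => by
    rw [character, Subsingleton.elim (ρ g) 0, map_zero]
  simp [innerG_eq_sum, hz] at h1

/-- Induction puts the irreducible characters of `S` above `t` in bijection with the irreducible
constituents of the character of `G` induced from `t`. -/
theorem card_constituents_eq [L.Normal] (ι : S →* G) (hι : Function.Injective ι)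
    (ht : IsInvariantLinear L t) (K : Subgroup S) [K.Normal]
    (hKL : K ≤ L) (htK : ∀ k ∈ K, t k = 1)
    (hM : ∀ x ∉ ι.range, ∃ l ∈ L, ∃ l' ∈ L, ι l' = x * ι l * x⁻¹ ∧ t l ≠ t l') (d : ℂ) :
    Nat.card ↥{χ | χ ∈ IrrConstituents G (indAlong ι (linearInd L t)) ∧ χ 1 = d} =
      Nat.card ↥{ψ : S ⧸ K → ℂ | ψ ∈ Irr (S ⧸ K) ∧
        ∀ l ∈ L, ψ (QuotientGroup.mk l) = (Nat.card S : ℂ) / Nat.card G * d * t l} := by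
  have hG : (Nat.card G : ℂ) ≠ 0 := Nat.cast_ne_zero.2 Nat.card_pos.ne'
  have hS : (Nat.card S : ℂ) ≠ 0 := Nat.cast_ne_zero.2 Nat.card_pos.ne'
  have hL : (Nat.card L : ℂ) ≠ 0 := Nat.cast_ne_zero.2 Nat.card_pos.ne'
  symm
  have hpull : ∀ ψ ∈ Irr (S ⧸ K), (fun s : S => ψ (QuotientGroup.mk s)) ∈ Irr S :=
    fun ψ hψ => ⟨hψ.1.comp_hom (QuotientGroup.mk' K), by rw [← innerG_quotient]; exact hψ.2⟩
  have hiso : ∀ ψ ∈ Irr S, (∀ l ∈ L, ψ l = ψ 1 * t l) → ∀ ψ' ∈ Irr S,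
      (∀ l ∈ L, ψ' l = ψ' 1 * t l) →
      innerG G (indAlong ι ψ) (indAlong ι ψ') = innerG S ψ ψ' := fun ψ hψ h ψ' hψ' h' =>
    innerG_indAlong_indAlong ι hι ht hM (hψ.1.mul_of_mem ht h) (hψ'.1.mul_of_mem ht h')
      hψ'.1.conj_invariant
  have hIrr : ∀ ψ ∈ Irr S, (∀ l ∈ L, ψ l = ψ 1 * t l) → indAlong ι ψ ∈ Irr G :=
    fun ψ hψ h => ⟨hψ.1.indAlong ι, by rw [hiso ψ hψ h ψ hψ h]; exact hψ.2⟩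
  have habove : ∀ ψ : S ⧸ K → ℂ,
      (∀ l ∈ L, ψ (QuotientGroup.mk l) = (Nat.card S : ℂ) / Nat.card G * d * t l) →
      ψ (QuotientGroup.mk 1) = (Nat.card S : ℂ) / Nat.card G * d ∧
      ∀ l ∈ L, ψ (QuotientGroup.mk l) = ψ (QuotientGroup.mk 1) * t l := fun ψ h => by
    have h1 := h 1 (one_mem L)
    rw [ht.one, mul_one] at h1
    exact ⟨h1, fun l hl => by rw [h1, h l hl]⟩
  refine Nat.card_congr (Set.BijOn.equiv
    (fun ψ : S ⧸ K → ℂ => indAlong ι fun s => ψ (QuotientGroup.mk s)) ⟨?_, ?_, ?_⟩)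
  · rintro ψ ⟨hψ, h⟩
    obtain ⟨h1, hab⟩ := habove ψ h
    have hψS := hpull ψ hψ
    refine ⟨⟨hIrr _ hψS hab, ?_⟩, ?_⟩
    · rw [innerG_indAlong_indAlong ι hι ht hM (linearInd_mul_of_mem ht)
        (hψS.1.mul_of_mem ht hab) hψS.1.conj_invariant, innerG_linearInd]
      have : ∀ l : L, t l * (starRingEnd ℂ) (ψ (QuotientGroup.mk (l : S))) =
          (starRingEnd ℂ) (ψ (QuotientGroup.mk 1)) := fun l => by
        rw [hab l l.2, map_mul, ← ht.inv l l.2, mul_left_comm, mul_comm (t l),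
          ht.inv_mul l.2, mul_one]
      simp only [this, Finset.sum_const, Finset.card_univ, nsmul_eq_mul,
        ← Nat.card_eq_fintype_card]
      rw [inv_mul_cancel_left₀ hL]
      have hpos : 0 < ψ (QuotientGroup.mk 1) := one_pos_of_mem_Irr hψS
      rwa [Complex.conj_eq_iff_im.2 (Complex.pos_iff.1 hpos).2.symm]
    · change indAlong ι _ 1 = d
      rw [indAlong_one ι hι, h1]
      field_simp
  · rintro ψ ⟨hψ, h⟩ ψ' ⟨hψ', h'⟩ e
    have hab := (habove ψ h).2
    have hab' := (habove ψ' h').2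
    have hψS := hpull ψ hψ
    have hψS' := hpull ψ' hψ'
    have e1 := hiso _ hψS hab _ hψS' hab'
    have e' : indAlong ι (fun s => ψ (QuotientGroup.mk s)) =
      indAlong ι (fun s => ψ' (QuotientGroup.mk s)) := e
    rw [← e', (hIrr _ hψS hab).2] at e1
    have e2 := eq_of_mem_Irr_of_innerG_ne_zero hψS hψS' (by rw [← e1]; exact one_ne_zero)
    ext x
    obtain ⟨s, rfl⟩ := QuotientGroup.mk_surjective x
    exact congrFun e2 s
  · rintro χ ⟨⟨hχ, hpos⟩, hd⟩
    rw [innerG_indAlong _ _ _ hχ.1.conj_invariant, innerG_linearInd] at hpos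
    obtain ⟨ψ, hψ, hab, hne⟩ := exists_mem_Irr_above ht (hχ.1.comp_hom ι)
      (right_ne_zero_of_mul hpos.ne')
    have heq : indAlong ι ψ = χ := eq_of_mem_Irr_of_innerG_ne_zero (hIrr ψ hψ hab) hχ
      (by rwa [innerG_indAlong _ _ _ hχ.1.conj_invariant])
    obtain ⟨ψ', hψ', hmk⟩ := hψ.1.exists_quotient ht hab K hKL htK
    have hfun : (fun s : S => ψ' (QuotientGroup.mk s)) = ψ := funext hmk
    refine ⟨ψ', ⟨⟨hψ', ?_⟩, fun l hl => ?_⟩, ?_⟩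
    · rw [innerG_quotient, hfun]; exact hψ.2
    · rw [hmk, hab l hl, ← hd, ← heq, indAlong_one ι hι]
      field_simp
    · simp only [hfun, heq]

end Invariant
/-! ### Units of an algebra group -/

section AlgGroup

variable {F : Type} [Field F] [Fintype F] {R : Type} [Ring R] [Algebra F R] [Fintype R]

theorem mem_algGroup_iff {A : NonUnitalSubalgebra F R} {u : Rˣ} :
    u ∈ algGroup F R A ↔ (u : R) - 1 ∈ A := by
  refine ⟨And.left, fun h => ⟨h, ?_⟩⟩
  have hpow : ∀ k : ℕ, ((u ^ k : Rˣ) : R) - 1 ∈ A := by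
    intro k
    induction k with
    | zero => simp
    | succ k ih =>
      have : ((u ^ (k + 1) : Rˣ) : R) - 1 =
          (((u ^ k : Rˣ) : R) - 1) * ((u : R) - 1) + (((u ^ k : Rˣ) : R) - 1) + ((u : R) - 1) := by
        rw [pow_succ]; push_cast; noncomm_ring
      rw [this]
      exact add_mem (add_mem (mul_mem ih h) ih) h
  have hinv : u⁻¹ ∈ Submonoid.powers u :=
    (isOfFinOrder_of_finite u).mem_powers_iff_mem_zpowers.2
      (inv_mem (Subgroup.mem_zpowers u))
  obtain ⟨k, hk⟩ := hinv
  rw [← hk]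
  exact hpow k

theorem algGroup_mono {A B : NonUnitalSubalgebra F R} (h : A ≤ B) :
    algGroup F R A ≤ algGroup F R B := fun _ hu => ⟨h hu.1, h hu.2⟩

theorem IsNil.mono {A B : NonUnitalSubalgebra F R} (hB : IsNil B) (h : A ≤ B) : IsNil A := by
  obtain ⟨N, hN⟩ := hB
  exact ⟨N, fun l hl => hN l fun x hx => h (hl x hx)⟩

theorem IsNil.exists_unit {A : NonUnitalSubalgebra F R} (hA : IsNil A) {y : R} (hy : y ∈ A) :
    ∃ u ∈ algGroup F R A, (u : R) = 1 + y := by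
  obtain ⟨N, hN⟩ := hA
  have hnil : IsNilpotent y := ⟨N, by
    rw [← List.prod_replicate]
    exact hN _ (fun x hx => List.eq_of_mem_replicate hx ▸ hy) List.length_replicate⟩
  obtain ⟨u, hu⟩ := hnil.isUnit_one_add
  exact ⟨u, mem_algGroup_iff.2 (by rwa [hu, add_sub_cancel_left]), hu⟩

theorem gElt_bijective {A : NonUnitalSubalgebra F R} (hA : IsNil A) :
    Function.Bijective (gElt (J := A)) := by
  constructor
  · intro g h e
    have : ((g : Rˣ) : R) - 1 = ((h : Rˣ) : R) - 1 := congrArg Subtype.val e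
    exact Subtype.ext (Units.ext (sub_left_injective this))
  · rintro ⟨y, hy⟩
    obtain ⟨u, hu, e⟩ := hA.exists_unit hy
    exact ⟨⟨u, hu⟩, Subtype.ext (by simp [gElt, e])⟩

theorem card_algGroup {A : NonUnitalSubalgebra F R} (hA : IsNil A) :
    Nat.card (algGroup F R A) = Nat.card A :=
  Nat.card_congr (Equiv.ofBijective _ (gElt_bijective hA))

end AlgGroup

/-! ### Sums over equivariant maps -/

section Fibers

variable {A : Type} [Group A] [Fintype A] {β : Type}

theorem card_fiber_eq (Φ : A → β) (hΦ : ∀ a b c, Φ b = Φ c → Φ (a * b) = Φ (a * c)) (a : A) :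
    (Finset.univ.filter fun b => Φ b = Φ a).card = Nat.card {b // Φ b = Φ 1} := by
  rw [← Fintype.card_subtype, ← Nat.card_eq_fintype_card]
  refine Nat.card_congr ((Equiv.mulLeft a⁻¹).subtypeEquiv fun b => ?_)
  constructor
  · intro h
    simpa using hΦ a⁻¹ b a h
  · intro h
    simpa using hΦ a _ _ h

theorem sum_comp_eq_card_mul_finsum (Φ : A → β)
    (hΦ : ∀ a b c, Φ b = Φ c → Φ (a * b) = Φ (a * c)) (f : β → ℂ) :
    ∑ a, f (Φ a) = Nat.card {b // Φ b = Φ 1} * ∑ᶠ μ ∈ Set.range Φ, f μ := by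
  have hr : Set.range Φ = ((Finset.univ.image Φ : Finset β) : Set β) := by simp
  rw [hr, finsum_mem_coe_finset, Finset.sum_comp, Finset.mul_sum]
  refine Finset.sum_congr rfl fun μ hμ => ?_
  obtain ⟨a, -, rfl⟩ := Finset.mem_image.1 hμ
  rw [card_fiber_eq Φ hΦ, nsmul_eq_mul]

theorem card_range_mul_card_fiber (Φ : A → β)
    (hΦ : ∀ a b c, Φ b = Φ c → Φ (a * b) = Φ (a * c)) :
    Nat.card (Set.range Φ) * Nat.card {b // Φ b = Φ 1} = Nat.card A := by
  have h := Finset.card_eq_sum_card_image Φ (Finset.univ : Finset A)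
  have h1 : ∀ μ ∈ Finset.univ.image Φ,
      (Finset.univ.filter fun b => Φ b = μ).card = Nat.card {b // Φ b = Φ 1} := by
    intro μ hμ
    obtain ⟨a, -, rfl⟩ := Finset.mem_image.1 hμ
    exact card_fiber_eq Φ hΦ a
  have hr : Set.range Φ = ((Finset.univ.image Φ : Finset β) : Set β) := by simp
  rw [Finset.sum_congr rfl h1, Finset.sum_const, smul_eq_mul, Finset.card_univ] at h
  rw [Nat.card_eq_fintype_card (α := A), h, hr, Nat.card_coe_set_eq, Set.ncard_coe_finset]

end Fibers
/-! ### The linear character of `L_λ` and the supercharacter as an induced character -/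

section Supercharacter

variable {F : Type} [Field F] [Fintype F] {R : Type} [Ring R] [Algebra F R] [Fintype R]
  {J : NonUnitalSubalgebra F R} {lam : ↥J →ₗ[F] F} {Λ : R →ₗ[F] F}

theorem exists_extend_functional (J : NonUnitalSubalgebra F R) (lam : ↥J →ₗ[F] F) :
    ∃ Λ : R →ₗ[F] F, ∀ X : J, lam X = Λ X := by
  obtain ⟨Λ, hΛ⟩ := LinearMap.exists_extend (p := J.toSubmodule) lam
  exact ⟨Λ, fun X => (LinearMap.congr_fun hΛ X).symm⟩

theorem lamE_eq (hΛ : ∀ X : J, lam X = Λ X) {x : R} (hx : x ∈ J) : lamE J lam x = Λ x := by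
  rw [lamE_apply J lam hx, hΛ]

theorem thetaFn_eq (θ : AddChar F ℂ) (hΛ : ∀ X : J, lam X = Λ X) (g : algGroup F R J) :
    thetaFn θ J lam g = θ (Λ (((g : Rˣ) : R) - 1)) := by
  rw [thetaFn, hΛ]; rfl

theorem mem_lone_iff (hΛ : ∀ X : J, lam X = Λ X) {x : R} :
    x ∈ lone J lam ↔ x ∈ J ∧ ∀ y ∈ J, Λ (x * y) = 0 := by
  refine and_congr_right fun hx => forall₂_congr fun y hy => ?_
  rw [lamE_eq hΛ (J.mul_mem hx hy)]

theorem mem_sone_iff (hΛ : ∀ X : J, lam X = Λ X) {x : R} :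
    x ∈ sone J lam ↔ x ∈ J ∧ ∀ y ∈ lone J lam, Λ (x * y) = 0 := by
  refine and_congr_right fun hx => forall₂_congr fun y hy => ?_
  rw [lamE_eq hΛ (J.mul_mem hx (lone_le J lam hy))]

theorem mem_kone_iff (hΛ : ∀ X : J, lam X = Λ X) {x : R} :
    x ∈ kone J lam ↔ x ∈ lone J lam ∧ Λ x = 0 := by
  refine and_congr_right fun hx => ?_
  rw [lamE_eq hΛ (lone_le J lam hx)]

theorem lone_le_sone (hΛ : ∀ X : J, lam X = Λ X) : lone J lam ≤ sone J lam := fun _ hx =>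
  (mem_sone_iff hΛ).2 ⟨lone_le J lam hx, fun y hy => ((mem_lone_iff hΛ).1 hx).2 y
    (lone_le J lam hy)⟩

theorem mem_LgrpIn_iff {l : algGroup F R (sone J lam)} :
    l ∈ LgrpIn J lam ↔ ((l : Rˣ) : R) - 1 ∈ lone J lam := by
  rw [LgrpIn, Subgroup.mem_subgroupOf, mem_algGroup_iff]

theorem mem_KgrpIn_iff {l : algGroup F R (sone J lam)} :
    l ∈ KgrpIn J lam ↔ ((l : Rˣ) : R) - 1 ∈ kone J lam := by
  rw [KgrpIn, Subgroup.mem_subgroupOf, mem_algGroup_iff]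

theorem card_LgrpIn (hΛ : ∀ X : J, lam X = Λ X) :
    Nat.card (LgrpIn J lam) = Nat.card (algGroup F R (lone J lam)) :=
  Nat.card_congr (Subgroup.subgroupOfEquivOfLe (algGroup_mono (lone_le_sone hΛ))).toEquiv

/-- Conjugating an element of `𝔩_λ` changes the value of `λ` by a commutator-like term. -/
theorem conj_mem_lone (hΛ : ∀ X : J, lam X = Λ X) {x : Rˣ} (hx : x ∈ algGroup F R J) {y : R}
    (hy : y ∈ lone J lam) (hxy : ((x : R) - 1) * y ∈ lone J lam) :
    (x : R) * y * ((x⁻¹ : Rˣ) : R) ∈ lone J lam ∧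
      Λ ((x : R) * y * ((x⁻¹ : Rˣ) : R)) = Λ y + Λ (((x : R) - 1) * y) := by
  set z := y + ((x : R) - 1) * y with hz
  have hzl : z ∈ lone J lam := add_mem hy hxy
  have e : (x : R) * y * ((x⁻¹ : Rˣ) : R) = z + z * (((x⁻¹ : Rˣ) : R) - 1) := by
    rw [hz]; noncomm_ring
  rw [e]
  exact ⟨add_mem hzl (lone_mul_mem J lam hzl hx.2), by
    rw [map_add, ((mem_lone_iff hΛ).1 hzl).2 _ hx.2, add_zero, hz, map_add]⟩

theorem isInvariantLinear_theta (θ : AddChar F ℂ) (hΛ : ∀ X : J, lam X = Λ X) :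
    IsInvariantLinear (LgrpIn J lam)
      (fun s : algGroup F R (sone J lam) => θ (Λ (((s : Rˣ) : R) - 1))) := by
  have hadd : ∀ l ∈ LgrpIn J lam, ∀ l' ∈ LgrpIn J lam,
      Λ (((l * l' : algGroup F R (sone J lam)) : Rˣ) - 1) =
        Λ (((l : Rˣ) : R) - 1) + Λ (((l' : Rˣ) : R) - 1) := by
    intro l hl l' hl'
    rw [mem_LgrpIn_iff] at hl hl'
    have e : (((l * l' : algGroup F R (sone J lam)) : Rˣ) : R) - 1 =
        (((l : Rˣ) : R) - 1) * (((l' : Rˣ) : R) - 1) +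
          ((((l : Rˣ) : R) - 1) + (((l' : Rˣ) : R) - 1)) := by
      push_cast; noncomm_ring
    rw [e, map_add, map_add, ((mem_lone_iff hΛ).1 hl).2 _ (lone_le J lam hl'), zero_add]
  refine ⟨by simp, fun l hl l' hl' => ?_, fun l hl => ?_, fun l hl s => ?_⟩
  · simp only [hadd l hl l' hl', AddChar.map_add_eq_mul]
  · have h := hadd l⁻¹ (inv_mem hl) l hl
    rw [inv_mul_cancel] at h
    have h' : Λ (((l⁻¹ : algGroup F R (sone J lam)) : Rˣ) - 1) = -Λ (((l : Rˣ) : R) - 1) :=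
      eq_neg_of_add_eq_zero_left (by rw [← h]; simp)
    simp only [h', AddChar.map_neg_eq_conj]
  · rw [mem_LgrpIn_iff] at hl
    have hs := s.2.1
    have h := (conj_mem_lone hΛ (algGroup_mono (sone_le J lam) s.2) hl
      (sone_mul_lone_mem J lam hs hl)).2
    rw [((mem_sone_iff hΛ).1 hs).2 _ hl, add_zero] at h
    have e : (((s * l * s⁻¹ : algGroup F R (sone J lam)) : Rˣ) : R) - 1 =
        ((s : Rˣ) : R) * (((l : Rˣ) : R) - 1) * (((s : Rˣ)⁻¹ : Rˣ) : R) := by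
      push_cast
      rw [mul_sub, sub_mul, mul_one, Units.mul_inv]
    simp only [e, h]

/-- An element of `J` outside `𝔰_λ` is detected by some `y ∈ 𝔩_λ` that it maps into `𝔩_λ`. -/
theorem exists_lone_mul_mem (hJ : IsNil J) (hΛ : ∀ X : J, lam X = Λ X) {x : R} (hx : x ∈ J)
    (hxs : x ∉ sone J lam) : ∃ y ∈ lone J lam, x * y ∈ lone J lam ∧ Λ (x * y) ≠ 0 := by
  obtain ⟨y₀, hy₀, h₀⟩ : ∃ y ∈ lone J lam, Λ (x * y) ≠ 0 := by
    by_contra! h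
    exact hxs ((mem_sone_iff hΛ).2 ⟨hx, h⟩)
  by_contra! hno
  have hstep : ∀ n : ℕ, ∃ l : List R, (∀ z ∈ l, z ∈ J) ∧ l.length = n ∧
      y₀ * l.prod ∈ lone J lam ∧ Λ (x * (y₀ * l.prod)) ≠ 0 := by
    intro n
    induction n with
    | zero => exact ⟨[], by simp, rfl, by simpa using hy₀, by simpa using h₀⟩
    | succ n ih =>
      obtain ⟨l, hl, hn, hm, hne⟩ := ih
      have hnot : x * (y₀ * l.prod) ∉ lone J lam := fun h => hne (hno _ hm h)
      obtain ⟨z, hz, hz0⟩ : ∃ z ∈ J, Λ (x * (y₀ * l.prod) * z) ≠ 0 := by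
        by_contra! h
        exact hnot ((mem_lone_iff hΛ).2 ⟨J.mul_mem hx (lone_le J lam hm), h⟩)
      have e : y₀ * (l ++ [z]).prod = y₀ * l.prod * z := by simp [mul_assoc]
      refine ⟨l ++ [z], ?_, by simp [hn], ?_, ?_⟩
      · intro w hw
        rcases List.mem_append.1 hw with h | h
        · exact hl w h
        · rwa [List.mem_singleton.1 h]
      · rw [e]; exact lone_mul_mem J lam hm hz
      · rwa [e, ← mul_assoc]
  obtain ⟨N, hN⟩ := hJ
  obtain ⟨l, hl, hn, -, hne⟩ := hstep N
  exact hne (by rw [hN l hl hn, mul_zero, mul_zero, map_zero])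

theorem exists_smul_addChar_ne_one {θ : AddChar F ℂ} (hθ : θ ≠ 1) {a : F} (ha : a ≠ 0) :
    ∃ c : F, θ (c * a) ≠ 1 := by
  obtain ⟨b, hb⟩ := AddChar.ne_one_iff.1 hθ
  exact ⟨b * a⁻¹, by rwa [mul_assoc, inv_mul_cancel₀ ha, mul_one]⟩

/-- Elements outside `S_λ` do not intertwine the linear character of `L_λ` with its conjugate. -/
theorem exists_conj_ne (hJ : IsNil J) {θ : AddChar F ℂ} (hθ : θ ≠ 1)
    (hΛ : ∀ X : J, lam X = Λ X) (x : algGroup F R J)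
    (hx : x ∉ (Subgroup.inclusion (algGroup_mono (sone_le J lam))).range) :
    ∃ l ∈ LgrpIn J lam, ∃ l' ∈ LgrpIn J lam,
      Subgroup.inclusion (algGroup_mono (sone_le J lam)) l' =
        x * Subgroup.inclusion (algGroup_mono (sone_le J lam)) l * x⁻¹ ∧
      θ (Λ (((l : Rˣ) : R) - 1)) ≠ θ (Λ (((l' : Rˣ) : R) - 1)) := by
  have hxs : ((x : Rˣ) : R) - 1 ∉ sone J lam := fun h =>
    hx ⟨⟨x, mem_algGroup_iff.2 h⟩, rfl⟩
  obtain ⟨y, hy, hxy, hne⟩ := exists_lone_mul_mem hJ hΛ x.2.1 hxs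
  obtain ⟨c, hc⟩ := exists_smul_addChar_ne_one hθ hne
  have hcy : c • y ∈ lone J lam := SMulMemClass.smul_mem c hy
  have hcxy : (((x : Rˣ) : R) - 1) * (c • y) ∈ lone J lam := by
    rw [mul_smul_comm]; exact SMulMemClass.smul_mem c hxy
  obtain ⟨u, hu, hue⟩ := (hJ.mono (lone_le J lam)).exists_unit hcy
  obtain ⟨hmem, hval⟩ := conj_mem_lone hΛ x.2 hcy hcxy
  have e : (((x : Rˣ) * u * (x : Rˣ)⁻¹ : Rˣ) : R) - 1 =
      ((x : Rˣ) : R) * (c • y) * (((x : Rˣ)⁻¹ : Rˣ) : R) := by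
    push_cast
    rw [hue, mul_add, add_mul, mul_one, Units.mul_inv, add_sub_cancel_left]
  have hu' : (x : Rˣ) * u * (x : Rˣ)⁻¹ ∈ algGroup F R (lone J lam) :=
    mem_algGroup_iff.2 (by rwa [e])
  refine ⟨⟨u, algGroup_mono (lone_le_sone hΛ) hu⟩, Subgroup.mem_subgroupOf.2 hu,
    ⟨_, algGroup_mono (lone_le_sone hΛ) hu'⟩, Subgroup.mem_subgroupOf.2 hu', rfl, ?_⟩
  change θ (Λ ((u : R) - 1)) ≠ θ (Λ ((((x : Rˣ) * u * (x : Rˣ)⁻¹ : Rˣ) : R) - 1))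
  rw [e, hval, hue, add_sub_cancel_left, mul_smul_comm, Λ.map_smul, Λ.map_smul, smul_eq_mul,
    smul_eq_mul, AddChar.map_add_eq_mul]
  intro h
  exact hc (mul_left_cancel₀ (AddChar.val_isUnit θ _ |>.ne_zero) (by rw [← h, mul_one]))

theorem leftAct_apply_eq (hΛ : ∀ X : J, lam X = Λ X) (g : algGroup F R J) (X : J) :
    leftAct g lam X = Λ (((g : Rˣ)⁻¹ : Rˣ) * (X : R)) := hΛ _

theorem rightAct_apply_eq (hΛ : ∀ X : J, lam X = Λ X) (g : algGroup F R J) (X : J) :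
    rightAct g lam X = Λ ((X : R) * ((g : Rˣ)⁻¹ : Rˣ)) := hΛ _

theorem leftAct_mul (g h : algGroup F R J) (mu : J →ₗ[F] F) :
    leftAct (g * h) mu = leftAct g (leftAct h mu) := by
  ext X
  refine congrArg mu (Subtype.ext ?_)
  change (((g : Rˣ) * (h : Rˣ))⁻¹ : Rˣ) * (X : R) =
    ((h : Rˣ)⁻¹ : Rˣ) * (((g : Rˣ)⁻¹ : Rˣ) * (X : R))
  rw [mul_inv_rev, Units.val_mul, mul_assoc]

theorem rightAct_mul (g h : algGroup F R J) (mu : J →ₗ[F] F) :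
    rightAct (g * h) mu = rightAct h (rightAct g mu) := by
  ext X
  refine congrArg mu (Subtype.ext ?_)
  change (X : R) * (((g : Rˣ) * (h : Rˣ))⁻¹ : Rˣ) =
    (X : R) * ((h : Rˣ)⁻¹ : Rˣ) * ((g : Rˣ)⁻¹ : Rˣ)
  rw [mul_inv_rev, Units.val_mul, mul_assoc]

theorem leftAct_rightAct_comm (g h : algGroup F R J) (mu : J →ₗ[F] F) :
    leftAct g (rightAct h mu) = rightAct h (leftAct g mu) := by
  ext X
  refine congrArg mu (Subtype.ext ?_)
  change ((g : Rˣ)⁻¹ : Rˣ) * (X : R) * ((h : Rˣ)⁻¹ : Rˣ) =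
    ((g : Rˣ)⁻¹ : Rˣ) * ((X : R) * ((h : Rˣ)⁻¹ : Rˣ))
  rw [mul_assoc]

theorem leftAct_eq_self_iff (hΛ : ∀ X : J, lam X = Λ X) (g : algGroup F R J) :
    leftAct g lam = lam ↔ (g : Rˣ) ∈ algGroup F R (lone J lam) := by
  rw [← inv_mem_iff, mem_algGroup_iff, mem_lone_iff hΛ, LinearMap.ext_iff]
  have hg := g.2.2
  simp only [hg, true_and, Subtype.forall, leftAct_apply_eq hΛ, hΛ, sub_mul, one_mul, map_sub,
    sub_eq_zero]

theorem leftAct_one (mu : J →ₗ[F] F) : leftAct (1 : algGroup F R J) mu = mu := by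
  ext X
  refine congrArg mu (Subtype.ext ?_)
  change (((1 : Rˣ)⁻¹ : Rˣ) : R) * (X : R) = X
  rw [inv_one, Units.val_one, one_mul]

/-- Orbits of `λ` under algebra subgroups containing `L_λ` have stabilizer `L_λ`. -/
theorem card_range_leftAct_mul (hΛ : ∀ X : J, lam X = Λ X) (A : NonUnitalSubalgebra F R)
    (hA : A ≤ J) (hl : lone J lam ≤ A) :
    Nat.card (Set.range fun s : algGroup F R A =>
        leftAct (Subgroup.inclusion (algGroup_mono hA) s) lam) *
      Nat.card (algGroup F R (lone J lam)) = Nat.card (algGroup F R A) := by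
  rw [← card_range_mul_card_fiber (fun s : algGroup F R A =>
        leftAct (Subgroup.inclusion (algGroup_mono hA) s) lam)]
  · congr 1
    rw [← Nat.card_congr (Subgroup.subgroupOfEquivOfLe (algGroup_mono hl)).toEquiv]
    refine Nat.card_congr (Equiv.subtypeEquivRight fun s => ?_)
    rw [map_one, leftAct_one, leftAct_eq_self_iff hΛ, Subgroup.mem_subgroupOf]
    rfl
  · intro a b c h
    simp only [map_mul, leftAct_mul] at h ⊢
    rw [h]

theorem card_leftOrbit_mul (hΛ : ∀ X : J, lam X = Λ X) :
    Nat.card (leftOrbit J lam) * Nat.card (algGroup F R (lone J lam)) =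
      Nat.card (algGroup F R J) :=
  card_range_leftAct_mul hΛ J le_rfl (lone_le J lam)

/-- A functional vanishing on the left kernel of `(X, Y) ↦ λ(XY)` is given by right
multiplication. -/
theorem exists_eq_mul_right (hΛ : ∀ X : J, lam X = Λ X) (φ : J →ₗ[F] F)
    (hφ : ∀ X : J, (X : R) ∈ lone J lam → φ X = 0) :
    ∃ Y : J, ∀ X : J, φ X = Λ ((X : R) * Y) := by
  let B : J →ₗ[F] Module.Dual F J := LinearMap.mk₂ F (fun X Y : J => Λ ((X : R) * (Y : R)))
    (fun X X' Y => by simp [add_mul]) (fun c X Y => by simp)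
    (fun X Y Y' => by simp [mul_add]) (fun c X Y => by simp)
  have hker : φ ∈ (LinearMap.ker B).dualAnnihilator := by
    rw [Submodule.mem_dualAnnihilator]
    intro X hX
    refine hφ X ((mem_lone_iff hΛ).2 ⟨X.2, fun y hy => ?_⟩)
    exact LinearMap.congr_fun (LinearMap.mem_ker.1 hX) ⟨y, hy⟩
  rw [← LinearMap.range_dualMap_eq_dualAnnihilator_ker] at hker
  obtain ⟨E, rfl⟩ := hker
  obtain ⟨Y, rfl⟩ := (Module.evalEquiv F J).surjective E
  exact ⟨Y, fun X => rfl⟩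

theorem leftOrbit_inter_rightOrbit (hJ : IsNil J) (hΛ : ∀ X : J, lam X = Λ X) :
    leftOrbit J lam ∩ rightOrbit J lam = Set.range fun s : algGroup F R (sone J lam) =>
      leftAct (Subgroup.inclusion (algGroup_mono (sone_le J lam)) s) lam := by
  ext mu
  constructor
  · rintro ⟨⟨g, rfl⟩, ⟨h, e⟩⟩
    have hg : (g : Rˣ)⁻¹ ∈ algGroup F R (sone J lam) := by
      rw [mem_algGroup_iff, mem_sone_iff hΛ]
      refine ⟨g.2.2, fun y hy => ?_⟩
      have e1 := LinearMap.congr_fun e ⟨y, lone_le J lam hy⟩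
      simp only [leftAct_apply_eq hΛ, rightAct_apply_eq hΛ] at e1
      have e2 : Λ (y * (((h : Rˣ)⁻¹ : Rˣ) - 1)) = 0 := ((mem_lone_iff hΛ).1 hy).2 _ h.2.2
      rw [mul_sub, mul_one, map_sub, sub_eq_zero] at e2
      rw [sub_mul, one_mul, map_sub, ← e1, e2, sub_self]
    exact ⟨⟨g, (inv_mem_iff).1 hg⟩, rfl⟩
  · rintro ⟨s, rfl⟩
    refine ⟨⟨_, rfl⟩, ?_⟩
    set g := Subgroup.inclusion (algGroup_mono (sone_le J lam)) s with hgdef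
    obtain ⟨Y, hY⟩ := exists_eq_mul_right hΛ (leftAct g lam - lam) fun X hX => by
      have := ((mem_sone_iff hΛ).1 s.2.2).2 X hX
      rw [sub_mul, one_mul, map_sub] at this
      rw [LinearMap.sub_apply, leftAct_apply_eq hΛ, hΛ]
      exact this
    obtain ⟨u, hu, hue⟩ := hJ.exists_unit Y.2
    refine ⟨⟨u⁻¹, inv_mem hu⟩, LinearMap.ext fun X => ?_⟩
    have h1 := hY X
    rw [LinearMap.sub_apply, sub_eq_iff_eq_add] at h1
    rw [h1, rightAct_apply_eq hΛ, hΛ]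
    simp only [inv_inv, hue, mul_add, mul_one, map_add]
    rw [add_comm]

theorem card_inter_mul (hJ : IsNil J) (hΛ : ∀ X : J, lam X = Λ X) :
    Nat.card ↥(leftOrbit J lam ∩ rightOrbit J lam) * Nat.card (algGroup F R (lone J lam)) =
      Nat.card (algGroup F R (sone J lam)) := by
  rw [leftOrbit_inter_rightOrbit hJ hΛ]
  exact card_range_leftAct_mul hΛ _ (sone_le J lam) (lone_le_sone hΛ)

theorem sum_theta_mul (hJ : IsNil J) {θ : AddChar F ℂ} (hθ : θ ≠ 1)
    (hΛ : ∀ X : J, lam X = Λ X) {w : R} (hw : w ∈ J) :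
    ∑ b : algGroup F R J, θ (Λ (w * ((b : Rˣ) : R))) =
      if w ∈ lone J lam then Nat.card (algGroup F R J) * θ (Λ w) else 0 := by
  have hb : ∀ b : algGroup F R J, θ (Λ (w * ((b : Rˣ) : R))) =
      θ (Λ w) * θ (Λ (w * (gElt b : R))) := fun b => by
    rw [← AddChar.map_add_eq_mul, ← map_add]
    congr 2
    simp [gElt, mul_sub]
  rw [Finset.sum_congr rfl fun b _ => hb b, ← Finset.mul_sum,
    (gElt_bijective hJ).sum_comp (fun Z : J => θ (Λ (w * (Z : R))))]
  split_ifs with h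
  · have : ∀ Z : J, θ (Λ (w * (Z : R))) = 1 := fun Z => by
      rw [((mem_lone_iff hΛ).1 h).2 _ Z.2, AddChar.map_zero_eq_one]
    rw [Finset.sum_congr rfl fun Z _ => this Z, Finset.sum_const, nsmul_eq_mul, mul_one, mul_comm,
      card_algGroup hJ, Nat.card_eq_fintype_card, Finset.card_univ]
  · let m : J →+ F := AddMonoidHom.mk' (fun Z : J => Λ (w * (Z : R))) fun Z Z' => by
      simp [mul_add]
    obtain ⟨z, hz, hz0⟩ : ∃ z ∈ J, Λ (w * z) ≠ 0 := by
      by_contra! h'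
      exact h ((mem_lone_iff hΛ).2 ⟨hw, h'⟩)
    obtain ⟨c, hc⟩ := exists_smul_addChar_ne_one hθ hz0
    have hne : θ.compAddMonoidHom m ≠ 1 := by
      refine AddChar.ne_one_iff.2 ⟨c • ⟨z, hz⟩, ?_⟩
      have : m (c • ⟨z, hz⟩) = c * Λ (w * z) := by
        change Λ (w * (c • z)) = _
        rw [mul_smul_comm, map_smul, smul_eq_mul]
      rwa [AddChar.compAddMonoidHom_apply, this]
    have := AddChar.sum_eq_zero_of_ne_one hne
    rw [show ∑ Z : J, θ (Λ (w * (Z : R))) = 0 from this, mul_zero]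

theorem superchar_eq_sum (hJ : IsNil J) {θ : AddChar F ℂ} (hθ : θ ≠ 1)
    (hΛ : ∀ X : J, lam X = Λ X) (g : algGroup F R J) :
    superchar θ J lam g = (Nat.card (algGroup F R (lone J lam)) : ℂ)⁻¹ *
      ∑ x : algGroup F R J, if (((x * g * x⁻¹ : algGroup F R J) : Rˣ) : R) - 1 ∈ lone J lam
        then θ (Λ ((((x * g * x⁻¹ : algGroup F R J) : Rˣ) : R) - 1)) else 0 := by
  let Φ : algGroup F R J × algGroup F R J → (J →ₗ[F] F) := fun p => leftAct p.1 (rightAct p.2⁻¹ lam)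
  have hΦ : ∀ a b c, Φ b = Φ c → Φ (a * b) = Φ (a * c) := by
    intro a b c h
    have : ∀ d, Φ (a * d) = leftAct a.1 (rightAct a.2⁻¹ (Φ d)) := fun d => by
      simp only [Φ, Prod.fst_mul, Prod.snd_mul, mul_inv_rev, leftAct_mul, rightAct_mul]
      rw [leftAct_rightAct_comm d.1 a.2⁻¹]
    rw [this, this, h]
  have hrange : Set.range Φ = twoOrbit J lam := by
    ext mu
    constructor
    · rintro ⟨p, rfl⟩
      exact ⟨p.1, p.2⁻¹, rfl⟩
    · rintro ⟨a, b, rfl⟩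
      exact ⟨(a, b⁻¹), by simp only [Φ, inv_inv]⟩
  have hsum := sum_comp_eq_card_mul_finsum Φ hΦ (fun mu => thetaFn θ J mu g)
  have hcard := card_range_mul_card_fiber Φ hΦ
  rw [hrange] at hsum hcard
  set c := Nat.card {b // Φ b = Φ 1}
  have hG0 : (Nat.card (algGroup F R J) : ℂ) ≠ 0 := Nat.cast_ne_zero.2 Nat.card_pos.ne'
  have hcard' : (Nat.card (twoOrbit J lam) : ℂ) * c = Nat.card (algGroup F R J) * Nat.card (algGroup F R J) := by
    rw [← Nat.cast_mul, hcard, Nat.card_prod, Nat.cast_mul]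
  have ht0 : (Nat.card (twoOrbit J lam) : ℂ) ≠ 0 :=
    left_ne_zero_of_mul (hcard'.trans_ne (mul_ne_zero hG0 hG0))
  have hleft : (Nat.card (leftOrbit J lam) : ℂ) * Nat.card (algGroup F R (lone J lam)) =
      Nat.card (algGroup F R J) := by rw [← Nat.cast_mul, card_leftOrbit_mul hΛ]
  have hl0 : (Nat.card (algGroup F R (lone J lam)) : ℂ) ≠ 0 :=
    right_ne_zero_of_mul (hleft.trans_ne hG0)
  have hval : ∀ x b : algGroup F R J, thetaFn θ J (Φ (x⁻¹, x⁻¹ * b)) g =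
      θ (Λ (((((x * g * x⁻¹ : algGroup F R J) : Rˣ) : R) - 1) * ((b : Rˣ) : R))) := by
    intro x b
    have h1 : Φ (x⁻¹, x⁻¹ * b) (gElt g) =
        Λ ((((x⁻¹ : algGroup F R J) : Rˣ)⁻¹ : Rˣ) * (((g : Rˣ) : R) - 1) *
          (((((x⁻¹ * b)⁻¹ : algGroup F R J) : Rˣ)⁻¹ : Rˣ) : R)) := hΛ _
    rw [thetaFn, h1]
    congr 2
    push_cast
    rw [inv_inv, inv_inv, mul_sub, mul_one, sub_mul, sub_mul, one_mul, Units.val_mul,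
      Units.mul_inv_cancel_left]
    simp only [mul_assoc]
  have hdouble : ∑ p, thetaFn θ J (Φ p) g = Nat.card (algGroup F R J) * ∑ x : algGroup F R J,
      if (((x * g * x⁻¹ : algGroup F R J) : Rˣ) : R) - 1 ∈ lone J lam
        then θ (Λ ((((x * g * x⁻¹ : algGroup F R J) : Rˣ) : R) - 1)) else 0 := by
    rw [Fintype.sum_prod_type, ← Equiv.sum_comp (Equiv.inv (algGroup F R J)), Finset.mul_sum]
    refine Finset.sum_congr rfl fun x _ => ?_
    rw [← Equiv.sum_comp (Equiv.mulLeft x⁻¹)]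
    simp only [Equiv.inv_apply, Equiv.coe_mulLeft, hval]
    rw [sum_theta_mul hJ hθ hΛ (x * g * x⁻¹ : algGroup F R J).2.1]
    split_ifs
    · rfl
    · rw [mul_zero]
  rw [hdouble] at hsum
  rw [superchar, eq_inv_mul_iff_mul_eq₀ hl0, ← mul_assoc, mul_div_assoc', mul_comm (_ : ℂ)
    (Nat.card (leftOrbit J lam) : ℂ), hleft, ← mul_right_inj' hG0, hsum, div_mul_eq_mul_div,
    mul_div_assoc', div_eq_iff ht0, ← mul_assoc, ← hcard']
  ring

theorem superchar_eq_indAlong (hJ : IsNil J) {θ : AddChar F ℂ} (hθ : θ ≠ 1)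
    (hΛ : ∀ X : J, lam X = Λ X) :
    superchar θ J lam = indAlong (Subgroup.inclusion (algGroup_mono (sone_le J lam)))
      (linearInd (LgrpIn J lam)
        (fun s : algGroup F R (sone J lam) => θ (Λ (((s : Rˣ) : R) - 1)))) := by
  ext g
  have hS : (Nat.card (algGroup F R (sone J lam)) : ℂ) ≠ 0 :=
    Nat.cast_ne_zero.2 Nat.card_pos.ne'
  rw [superchar_eq_sum hJ hθ hΛ, indAlong, Finset.mul_sum, Finset.mul_sum]
  refine Finset.sum_congr rfl fun x _ => ?_
  set y := x * g * x⁻¹ with hy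
  split_ifs with h
  · obtain ⟨s₀, hs₀⟩ : ∃ s₀ : algGroup F R (sone J lam), (s₀ : Rˣ) = y :=
      ⟨⟨y, mem_algGroup_iff.2 (lone_le_sone hΛ h)⟩, rfl⟩
    have hiff : ∀ s, (Subgroup.inclusion (algGroup_mono (sone_le J lam)) s = y) = (s = s₀) :=
      fun s => by
        rw [eq_iff_iff, Subtype.ext_iff, Subtype.ext_iff, hs₀]
        rfl
    have hmem : s₀ ∈ LgrpIn J lam := mem_LgrpIn_iff.2 (by rwa [hs₀])
    simp only [hiff, Finset.sum_ite_eq', Finset.mem_univ, if_true]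
    rw [linearInd, if_pos hmem, card_LgrpIn hΛ, hs₀]
    field_simp
  · rw [mul_zero, Finset.sum_eq_zero, mul_zero]
    intro s _
    split_ifs with e
    · rw [linearInd, if_neg]
      rw [mem_LgrpIn_iff]
      rwa [← e] at h
    · rfl

end Supercharacter
theorem statement3 (F : Type) [Field F] [Fintype F]
    (R : Type) [Ring R] [Algebra F R] [Fintype R]
    (J : NonUnitalSubalgebra F R) (hJ : IsNil J)
    (θ : AddChar F ℂ) (hθ : θ ≠ 1)
    (lam : ↥J →ₗ[F] F) (e : ℕ) :
    Nat.card ↥{ψ | ψ ∈ IrrConstituents ↥(algGroup F R J) (superchar θ J lam) ∧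
        ψ 1 = (Fintype.card F : ℂ) ^ e} =
      Nat.card ↥{ψ : (↥(algGroup F R (sone J lam)) ⧸ KgrpIn J lam) → ℂ |
        ψ ∈ Irr (↥(algGroup F R (sone J lam)) ⧸ KgrpIn J lam) ∧
        ∀ (z : Rˣ) (hzS : z ∈ algGroup F R (sone J lam)),
          z ∈ algGroup F R (lone J lam) → ∀ (hzG : z ∈ algGroup F R J),
          ψ (QuotientGroup.mk ⟨z, hzS⟩) =
            ((Nat.card ↥(leftOrbit J lam ∩ rightOrbit J lam) : ℂ) /
                (Nat.card ↥(leftOrbit J lam) : ℂ)) *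
              (Fintype.card F : ℂ) ^ e * thetaFn θ J lam ⟨z, hzG⟩} := by
  obtain ⟨Λ, hΛ⟩ := exists_extend_functional J lam
  have hkone : ∀ k ∈ KgrpIn J lam, θ (Λ (((k : Rˣ) : R) - 1)) = 1 := fun k hk => by
    rw [((mem_kone_iff hΛ).1 (mem_KgrpIn_iff.1 hk)).2, AddChar.map_zero_eq_one]
  have hc : (Nat.card (algGroup F R (lone J lam)) : ℂ) ≠ 0 :=
    Nat.cast_ne_zero.2 Nat.card_pos.ne'
  have hratio : (Nat.card ↥(leftOrbit J lam ∩ rightOrbit J lam) : ℂ) /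
      (Nat.card ↥(leftOrbit J lam) : ℂ) =
      (Nat.card (algGroup F R (sone J lam)) : ℂ) / Nat.card (algGroup F R J) := by
    rw [← card_inter_mul hJ hΛ, ← card_leftOrbit_mul hΛ, Nat.cast_mul, Nat.cast_mul,
      mul_div_mul_right _ _ hc]
  rw [superchar_eq_indAlong hJ hθ hΛ, card_constituents_eq _ (Subgroup.inclusion_injective _)
    (isInvariantLinear_theta θ hΛ) (KgrpIn J lam)
    (fun k hk => mem_LgrpIn_iff.2 (kone_le J lam (mem_KgrpIn_iff.1 hk))) hkone
    (exists_conj_ne hJ hθ hΛ)]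
  refine Nat.card_congr (Equiv.setCongr (Set.ext fun ψ => and_congr_right fun _ => ?_))
  rw [hratio]
  constructor
  · intro h z hzS hzL hzG
    rw [thetaFn_eq θ hΛ]
    exact h ⟨z, hzS⟩ (Subgroup.mem_subgroupOf.2 hzL)
  · intro h l hl
    have := h l l.2 (Subgroup.mem_subgroupOf.1 hl) (algGroup_mono (sone_le J lam) l.2)
    rwa [thetaFn_eq θ hΛ] at this

end IterChar
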